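/- arXiv:2401.06352 — 4 statements merged into one kernel-verified Lean document; each statement's English description precedes it below -/
import Mathlib

section
/- Fix T > 0, let U ⊂ ℝᵐ be compact and nonempty, and let f : [0,T] × ℝⁿ × U → ℝⁿ be continuous and Lipschitz continuous in x uniformly in (s,u). Let g : ℝⁿ → ℝ be continuous and of class Z, and define the value function v(t,x) = inf over measurable controls u : [t,T] → U of g(φ(T;t,x,u)); assume v is continuous on [0,T] × ℝⁿ and that for every (t,x) the infimum is attained by some measurable control u* (which holds when the velocity sets f(s,x,U) are convex). Then for every t ∈ [0,T], the map x ↦ v(t,x) is of class Z. -/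
open Set

noncomputable section

/-- A function `z` is of class `Z` if for every `x̄` with `z x̄ = 0` and every `r > 0`
there is a point of the open ball `B_r(x̄)` where `z` is negative. -/
def ClassZ {E : Type*} [NormedAddCommGroup E] (z : E → ℝ) : Prop :=
  ∀ x : E, z x = 0 → ∀ r : ℝ, 0 < r → ∃ y ∈ Metric.ball x r, z y < 0

/-- A measurable control valued in `U` on `[t, T]`. -/
def Admissible {α : Type*} [MeasurableSpace α] (U : Set α) (t T : ℝ) (u : ℝ → α) : Prop :=
  Measurable u ∧ ∀ s ∈ Set.Icc t T, u s ∈ U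

/-- `X` is the (absolutely continuous) trajectory of `ẋ(s) = f(s, x(s), u(s))` on `[t, T]`
with `X t = x`, written in integral form. -/
def IsTraj {n m : ℕ} (f : ℝ → EuclideanSpace ℝ (Fin n) → (Fin m → ℝ) → EuclideanSpace ℝ (Fin n))
    (t T : ℝ) (x : EuclideanSpace ℝ (Fin n)) (u : ℝ → (Fin m → ℝ))
    (X : ℝ → EuclideanSpace ℝ (Fin n)) : Prop :=
  ContinuousOn X (Set.Icc t T) ∧
    ∀ s ∈ Set.Icc t T, X s = x + ∫ r in t..s, f r (X r) (u r)

open MeasureTheory Filter Topology in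
theorem aux_ode {E : Type*} [NormedAddCommGroup E] [NormedSpace ℝ E] [CompleteSpace E]
    (t T : ℝ) (htT : t ≤ T) (F : ℝ → E → E) (L : ℝ) (hL : 0 ≤ L)
    (hF : ∀ s ∈ Icc t T, ∀ x y : E, ‖F s x - F s y‖ ≤ L * ‖x - y‖)
    (hint : ∀ Y : ℝ → E, ContinuousOn Y (Icc t T) →
      IntervalIntegrable (fun r => F r (Y r)) volume t T)
    (x : E) (X : ℝ → E) (hXc : ContinuousOn X (Icc t T))
    (hX : ∀ s ∈ Icc t T, X s = x + ∫ r in t..s, F r (X r)) (y : E) :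
    ∃ Y : ℝ → E, ContinuousOn Y (Icc t T) ∧ Y T = y ∧
      (∀ s ∈ Icc t T, Y s = Y t + ∫ r in t..s, F r (Y r)) ∧
      ‖Y t - x‖ ≤ 2 * (‖y - X T‖ * Real.exp (2 * L * (T - t))) := by
  have hsub : ∀ a ∈ Icc t T, ∀ b ∈ Icc t T, uIcc a b ⊆ uIcc t T := by
    intro a ha b hb
    rw [uIcc_of_le htT]
    exact (convex_Icc t T).ordConnected.uIcc_subset ha hb
  have htm : t ∈ Icc t T := left_mem_Icc.2 htT
  have hTm : T ∈ Icc t T := right_mem_Icc.2 htT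
  have hint' : ∀ Y : ℝ → E, ContinuousOn Y (Icc t T) → ∀ a ∈ Icc t T, ∀ b ∈ Icc t T,
      IntervalIntegrable (fun r => F r (Y r)) volume a b := fun Y hY a ha b hb =>
    (hint Y hY).mono_set (hsub a ha b hb)
  obtain ⟨Y, hY0, hYs⟩ : ∃ Y : ℕ → ℝ → E, Y 0 = X ∧
      ∀ k s, Y (k+1) s = y - ∫ r in s..T, F r (Y k r) :=
    ⟨fun k => Nat.rec X (fun _ Z s => y - ∫ r in s..T, F r (Z r)) k, rfl, fun _ _ => rfl⟩
  have hYc : ∀ k, ContinuousOn (Y k) (Icc t T) := by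
    intro k
    induction k with
    | zero => rw [hY0]; exact hXc
    | succ k ih =>
      have h1 : ContinuousOn (fun s => ∫ r in s..T, F r (Y k r)) (Icc t T) := by
        have := intervalIntegral.continuousOn_primitive_interval_left (μ := volume)
          (f := fun r => F r (Y k r)) (a := t) (b := T) (by
            have := (intervalIntegrable_iff_integrableOn_Icc_of_le htT).1 (hint _ ih)
            rwa [uIcc_of_le htT])
        rwa [uIcc_of_le htT] at this
      exact (continuousOn_const.sub h1).congr fun s _ => hYs k s
  set δ := ‖y - X T‖ with hδ
  have hexp : ∀ s, ∫ r in s..T, 2 * L * Real.exp (2 * L * (T - r))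
      = Real.exp (2 * L * (T - s)) - 1 := by
    intro s
    have hd : ∀ r ∈ uIcc s T, HasDerivAt (fun r => - Real.exp (2 * L * (T - r)))
        (2 * L * Real.exp (2 * L * (T - r))) r := by
      intro r _
      have h : HasDerivAt (fun r => - Real.exp (2 * L * (T - r)))
          (-(Real.exp (2 * L * (T - r)) * (2 * L * (-1)))) r :=
        (((hasDerivAt_id r).const_sub T).const_mul (2 * L)).exp.neg
      have he : 2 * L * Real.exp (2 * L * (T - r))
          = -(Real.exp (2 * L * (T - r)) * (2 * L * (-1))) := by ring
      rw [he]
      exact h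
    rw [intervalIntegral.integral_eq_sub_of_hasDerivAt hd
      (Continuous.intervalIntegrable (by fun_prop) _ _)]
    simp; ring
  have key : ∀ k, ∀ s ∈ Icc t T,
      ‖Y (k+1) s - Y k s‖ ≤ δ * (1/2)^k * Real.exp (2 * L * (T - s)) := by
    intro k
    induction k with
    | zero =>
      intro s hs
      have h1 : Y (0+1) s - Y 0 s = y - X T := by
        rw [hYs, hY0, hX s hs, hX T hTm,
          ← intervalIntegral.integral_add_adjacent_intervals (hint' X hXc t htm s hs)
            (hint' X hXc s hs T hTm)]
        abel
      rw [h1]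
      have : 1 ≤ Real.exp (2 * L * (T - s)) := Real.one_le_exp (by
        have := hs.2
        have : 0 ≤ T - s := by linarith
        positivity)
      have h0 : 0 ≤ δ := norm_nonneg _
      rw [← hδ]
      nlinarith
    | succ k ih =>
      intro s hs
      have h1 : Y (k+1+1) s - Y (k+1) s
          = - ∫ r in s..T, (F r (Y (k+1) r) - F r (Y k r)) := by
        rw [intervalIntegral.integral_sub (hint' _ (hYc _) s hs T hTm)
          (hint' _ (hYc _) s hs T hTm), hYs (k+1), hYs k]
        abel
      rw [h1, norm_neg]
      have h2 : ‖∫ r in s..T, (F r (Y (k+1) r) - F r (Y k r))‖ ≤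
          ∫ r in s..T, (δ * (1/2)^(k+1)) * (2 * L * Real.exp (2 * L * (T - r))) := by
        apply intervalIntegral.norm_integral_le_of_norm_le hs.2
        · refine Eventually.of_forall fun r hr => ?_
          have hr' : r ∈ Icc t T := ⟨hs.1.trans hr.1.le, hr.2⟩
          calc _ ≤ L * ‖Y (k+1) r - Y k r‖ := hF r hr' _ _
            _ ≤ L * (δ * (1/2)^k * Real.exp (2 * L * (T - r))) := by
              gcongr; exact ih r hr'
            _ = _ := by ring
        · exact Continuous.intervalIntegrable (by fun_prop) _ _
      rw [intervalIntegral.integral_const_mul, hexp] at h2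
      refine h2.trans ?_
      have : 0 ≤ δ * (1/2)^(k+1) := by positivity
      nlinarith
  set C := δ * Real.exp (2 * L * (T - t)) with hC
  have key2 : ∀ s ∈ Icc t T, ∀ k, dist (Y k s) (Y (k+1) s) ≤ (2 * C) / 2 / 2^k := by
    intro s hs k
    rw [dist_comm, dist_eq_norm]
    refine (key k s hs).trans ?_
    have h1 : Real.exp (2 * L * (T - s)) ≤ Real.exp (2 * L * (T - t)) := by
      have := hs.1
      gcongr
    calc _ ≤ δ * (1/2)^k * Real.exp (2 * L * (T - t)) := by gcongr
      _ = _ := by rw [hC, one_div, inv_pow]; field_simp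
  have hlim : ∀ s, ∃ z, s ∈ Icc t T → Tendsto (fun k => Y k s) atTop (𝓝 z) := by
    intro s
    by_cases hs : s ∈ Icc t T
    · obtain ⟨z, hz⟩ := cauchySeq_tendsto_of_complete (cauchySeq_of_le_geometric_two (key2 s hs))
      exact ⟨z, fun _ => hz⟩
    · exact ⟨0, fun h => absurd h hs⟩
  choose Z hZ using hlim
  have hd : ∀ s ∈ Icc t T, ∀ k, dist (Y k s) (Z s) ≤ 2 * C / 2^k := fun s hs k =>
    dist_le_of_le_geometric_two_of_tendsto (key2 s hs) (hZ s hs) k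
  have hgeo : ∀ A : ℝ, Tendsto (fun k : ℕ => A / 2^k) atTop (𝓝 0) := by
    intro A
    have := (tendsto_pow_atTop_nhds_zero_of_lt_one (r := (1/2 : ℝ)) (by norm_num)
      (by norm_num)).const_mul A
    simpa [div_eq_mul_inv] using this
  have hu : TendstoUniformlyOn Y Z atTop (Icc t T) := by
    rw [Metric.tendstoUniformlyOn_iff]
    intro ε hε
    filter_upwards [(hgeo (2 * C)).eventually_lt_const hε] with k hk s hs
    rw [dist_comm]
    exact (hd s hs k).trans_lt hk
  have hZc : ContinuousOn Z (Icc t T) := hu.continuousOn (Frequently.of_forall hYc)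
  have hZeq : ∀ s ∈ Icc t T, Z s = y - ∫ r in s..T, F r (Z r) := by
    intro s hs
    have h1 : Tendsto (fun k => Y (k+1) s) atTop (𝓝 (Z s)) :=
      (hZ s hs).comp (tendsto_add_atTop_nat 1)
    refine tendsto_nhds_unique h1 ?_
    simp only [hYs]
    refine tendsto_const_nhds.sub ?_
    rw [tendsto_iff_norm_sub_tendsto_zero]
    refine squeeze_zero (fun _ => norm_nonneg _) (fun k => ?_) (hgeo (L * (2 * C) * |T - s|))
    rw [← intervalIntegral.integral_sub (hint' _ (hYc _) s hs T hTm)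
          (hint' _ hZc s hs T hTm)]
    have : ∀ r ∈ uIoc s T, ‖F r (Y k r) - F r (Z r)‖ ≤ L * (2 * C / 2^k) := by
      intro r hr
      rw [uIoc_of_le hs.2] at hr
      have hr' : r ∈ Icc t T := ⟨hs.1.trans hr.1.le, hr.2⟩
      refine (hF r hr' _ _).trans ?_
      rw [← dist_eq_norm]
      gcongr
      exact hd r hr' k
    refine (intervalIntegral.norm_integral_le_of_norm_le_const this).trans (le_of_eq ?_)
    ring
  refine ⟨Z, hZc, ?_, ?_, ?_⟩
  · simpa using hZeq T hTm
  · intro s hs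
    rw [hZeq s hs, hZeq t htm, ← intervalIntegral.integral_add_adjacent_intervals
      (hint' Z hZc t htm s hs) (hint' Z hZc s hs T hTm)]
    abel
  · have h := hd t htm 0
    have hx : X t = x := by simpa using hX t htm
    rw [hY0, hx, dist_comm, dist_eq_norm] at h
    simpa using h

open MeasureTheory Filter Topology in
theorem aux_int {E W : Type*} [NormedAddCommGroup E] [NormedSpace ℝ E] [MeasurableSpace E]
    [BorelSpace E] [SecondCountableTopology E]
    [TopologicalSpace W] [T2Space W] [MeasurableSpace W] [BorelSpace W]
    [SecondCountableTopology W]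
    (t T : ℝ) (h0 : 0 ≤ t) (htT : t ≤ T) (U : Set W) (hUc : IsCompact U)
    (f : ℝ → E → W → E)
    (hfc : ContinuousOn (fun z : ℝ × E × W => f z.1 z.2.1 z.2.2)
      (Icc 0 T ×ˢ (univ : Set E) ×ˢ U))
    (u : ℝ → W) (hu : Measurable u) (huU : ∀ s ∈ Icc t T, u s ∈ U)
    (Y : ℝ → E) (hY : ContinuousOn Y (Icc t T)) :
    IntervalIntegrable (fun r => f r (Y r) (u r)) volume t T := by
  classical
  set S : Set (ℝ × E × W) := Icc 0 T ×ˢ (univ : Set E) ×ˢ U with hS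
  have hSm : MeasurableSet S :=
    (measurableSet_Icc).prod (MeasurableSet.univ.prod hUc.measurableSet)
  have hG : Measurable (S.piecewise (fun z : ℝ × E × W => f z.1 z.2.1 z.2.2) (fun _ => 0)) :=
    hfc.measurable_piecewise continuousOn_const hSm
  have hYt : Continuous (IccExtend htT ((Icc t T).domRestrict Y)) :=
    (continuousOn_iff_continuous_domRestrict.1 hY).Icc_extend'
  have hmeas : Measurable (fun r => S.piecewise (fun z : ℝ × E × W => f z.1 z.2.1 z.2.2)
      (fun _ => 0) (r, IccExtend htT ((Icc t T).domRestrict Y) r, u r)) :=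
    hG.comp (measurable_id.prodMk (hYt.measurable.prodMk hu))
  have heq : ∀ r ∈ Icc t T, S.piecewise (fun z : ℝ × E × W => f z.1 z.2.1 z.2.2)
      (fun _ => 0) (r, IccExtend htT ((Icc t T).domRestrict Y) r, u r) = f r (Y r) (u r) := by
    intro r hr
    have hm : (r, IccExtend htT ((Icc t T).domRestrict Y) r, u r) ∈ S :=
      ⟨⟨h0.trans hr.1, hr.2⟩, mem_univ _, huU r hr⟩
    rw [piecewise_eq_of_mem _ _ _ hm]
    simp only [IccExtend_of_mem htT _ hr]
    rfl
  have hK : IsCompact (Icc t T ×ˢ (Y '' Icc t T) ×ˢ U) :=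
    isCompact_Icc.prod ((isCompact_Icc.image_of_continuousOn hY).prod hUc)
  obtain ⟨M, hM⟩ := hK.exists_bound_of_continuousOn (hfc.mono (by
    rintro ⟨a, b, c⟩ ⟨ha, hb, hc⟩
    exact ⟨⟨h0.trans ha.1, ha.2⟩, mem_univ _, hc⟩))
  rw [intervalIntegrable_iff_integrableOn_Icc_of_le htT]
  refine Integrable.of_bound (C := M) ?_ ?_
  · refine hmeas.aestronglyMeasurable.congr ?_
    exact (ae_restrict_iff' measurableSet_Icc).2 (Eventually.of_forall heq)
  · refine (ae_restrict_iff' measurableSet_Icc).2 (Eventually.of_forall fun r hr => ?_)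
    exact hM (r, Y r, u r) ⟨hr, mem_image_of_mem _ hr, huU r hr⟩

/-- If the terminal cost `g` is of class `Z`, then the (continuous, attained) value function
`v(t,x) = inf_u g(φ(T;t,x,u))` of the Mayer problem is of class `Z` in `x` for every
`t ∈ [0,T]`.  The hypothesis `hv` (`IsLeast`) states both that `v t x` is the infimum of the
achievable terminal costs and that this infimum is attained by some measurable control. -/
theorem value_function_classZ {n m : ℕ} (T : ℝ) (hT : 0 < T)
    (U : Set (Fin m → ℝ)) (hUc : IsCompact U) (hUne : U.Nonempty)
    (f : ℝ → EuclideanSpace ℝ (Fin n) → (Fin m → ℝ) → EuclideanSpace ℝ (Fin n))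
    (hfc : ContinuousOn
      (fun z : ℝ × EuclideanSpace ℝ (Fin n) × (Fin m → ℝ) => f z.1 z.2.1 z.2.2)
      (Set.Icc 0 T ×ˢ (Set.univ : Set (EuclideanSpace ℝ (Fin n))) ×ˢ U))
    (L : ℝ) (hL : 0 ≤ L)
    (hfl : ∀ s ∈ Set.Icc (0 : ℝ) T, ∀ w ∈ U, ∀ x y : EuclideanSpace ℝ (Fin n),
      ‖f s x w - f s y w‖ ≤ L * ‖x - y‖)
    (g : EuclideanSpace ℝ (Fin n) → ℝ) (hg : Continuous g) (hgZ : ClassZ g)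
    (v : ℝ → EuclideanSpace ℝ (Fin n) → ℝ)
    (hv : ∀ t ∈ Set.Icc (0 : ℝ) T, ∀ x,
      IsLeast {y : ℝ | ∃ u X, Admissible U t T u ∧ IsTraj f t T x u X ∧ y = g (X T)} (v t x))
    (hvc : ContinuousOn (fun z : ℝ × EuclideanSpace ℝ (Fin n) => v z.1 z.2)
      (Set.Icc 0 T ×ˢ (Set.univ : Set (EuclideanSpace ℝ (Fin n))))) :
    ∀ t ∈ Set.Icc (0 : ℝ) T, ClassZ (v t) := by
  intro t ht x hx r hr
  obtain ⟨⟨u, X, hu, hX, hgX⟩, -⟩ := hv t ht x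
  rw [hx] at hgX
  set K := Real.exp (2 * L * (T - t)) with hK
  have hKpos : 0 < K := Real.exp_pos _
  obtain ⟨y, hy, hgy⟩ := hgZ (X T) hgX.symm (r / (2 * K)) (by positivity)
  obtain ⟨Y, hYc, hYT, hYeq, hYd⟩ := aux_ode t T ht.2 (fun s z => f s z (u s)) L hL
    (fun s hs a b => hfl s ⟨ht.1.trans hs.1, hs.2⟩ (u s) (hu.2 s hs) a b)
    (fun Y hY => aux_int t T ht.1 ht.2 U hUc f hfc u hu.1 hu.2 Y hY)
    x X hX.1 hX.2 y
  refine ⟨Y t, ?_, ?_⟩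
  · rw [Metric.mem_ball, dist_eq_norm] at hy ⊢
    rw [lt_div_iff₀ (by positivity)] at hy
    refine hYd.trans_lt ?_
    rw [← hK]
    linarith
  · refine lt_of_le_of_lt ((hv t ht (Y t)).2 ⟨u, Y, hu, ⟨hYc, hYeq⟩, rfl⟩) ?_
    rw [hYT]
    exact hgy

end
end

section
/- Fix T > 0, let U ⊂ ℝᵐ be compact and nonempty, let f : [0,T] × ℝⁿ × U → ℝⁿ be continuous and Lipschitz continuous in x uniformly in (s,u), and define the Hamiltonian H(t,x,p) = max_{u ∈ U} ⟨−p, f(t,x,u)⟩. Let v : [0,T] × ℝⁿ → ℝ be continuous and suppose that for every (t₀,x₀) ∈ (0,T) × ℝⁿ with v(t₀,x₀) > 0 and every Fréchet supergradient (p_t, p_x) ∈ D⁺v(t₀,x₀), one has −p_t + H(t₀,x₀,p_x) ≤ 0. Then the truncation v_×(t,x) := max{v(t,x), 0} is continuous and satisfies: for every (t₀,x₀) ∈ (0,T) × ℝⁿ and every (p_t,p_x) ∈ D⁺v_×(t₀,x₀), −p_t + H(t₀,x₀,p_x) ≤ 0; moreover v_×(T,x) = max{v(T,x), 0} for all x ∈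 ℝⁿ. -/
open scoped RealInnerProductSpace
open Set

noncomputable section

/-- `(pt, px)` is a Fréchet supergradient of `w` at `(t₀, x₀)`:
the limsup as `(t,x) → (t₀,x₀)` of
`[w(t,x) − w(t₀,x₀) − ⟨(pt,px), (t,x) − (t₀,x₀)⟩]/‖(t,x) − (t₀,x₀)‖` is nonpositive. -/
def IsSupGrad {n : ℕ} (w : ℝ → EuclideanSpace ℝ (Fin n) → ℝ) (t₀ : ℝ)
    (x₀ : EuclideanSpace ℝ (Fin n)) (pt : ℝ) (px : EuclideanSpace ℝ (Fin n)) : Prop :=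
  ∀ ε : ℝ, 0 < ε →
    ∀ᶠ z : ℝ × EuclideanSpace ℝ (Fin n) in nhdsWithin (t₀, x₀) {(t₀, x₀)}ᶜ,
      w z.1 z.2 - w t₀ x₀ - (pt * (z.1 - t₀) + ⟪px, z.2 - x₀⟫) ≤ ε * ‖(z.1 - t₀, z.2 - x₀)‖

theorem supgrad_zero_aux {n : ℕ} (w : ℝ → EuclideanSpace ℝ (Fin n) → ℝ) (t₀ : ℝ)
    (x₀ : EuclideanSpace ℝ (Fin n)) (pt : ℝ) (px : EuclideanSpace ℝ (Fin n))
    (hw : ∀ t x, w t₀ x₀ ≤ w t x) (h : IsSupGrad w t₀ x₀ pt px) : pt = 0 ∧ px = 0 := by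
  by_contra hne
  have hp : (pt, px) ≠ (0 : ℝ × EuclideanSpace ℝ (Fin n)) := by
    intro h0
    exact hne (Prod.mk_eq_zero.mp h0)
  have hM : 0 < ‖(pt, px)‖ := norm_pos_iff.mpr hp
  have hev := h (‖(pt, px)‖ / 2) (by positivity)
  have hcont : Continuous (fun s : ℝ => (t₀, x₀) - s • (pt, px)) := by fun_prop
  have ht : Filter.Tendsto (fun s : ℝ => (t₀, x₀) - s • (pt, px)) (nhdsWithin 0 (Ioi 0))
      (nhdsWithin (t₀, x₀) {(t₀, x₀)}ᶜ) := by
    apply tendsto_nhdsWithin_of_tendsto_nhds_of_eventually_within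
    · have := hcont.tendsto 0
      rw [zero_smul, sub_zero] at this
      exact this.mono_left nhdsWithin_le_nhds
    · filter_upwards [self_mem_nhdsWithin] with s hs h0
      have h1 : s • (pt, px) = 0 := by
        have h2 : (t₀, x₀) - s • (pt, px) = (t₀, x₀) := h0
        exact sub_eq_self.mp h2
      exact (smul_ne_zero (ne_of_gt hs) hp) h1
  obtain ⟨s, hs, hs0⟩ := ((ht.eventually hev).and self_mem_nhdsWithin).exists
  have hs0 : 0 < s := hs0
  have e : (((t₀, x₀) - s • (pt, px)).1 - t₀, ((t₀, x₀) - s • (pt, px)).2 - x₀)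
      = (-s) • (pt, px) := by
    ext <;> simp
  rw [e, norm_smul, Real.norm_eq_abs, abs_neg, abs_of_pos hs0] at hs
  have e1 : ((t₀, x₀) - s • (pt, px)).1 - t₀ = -(s * pt) := by simp
  have e2 : ((t₀, x₀) - s • (pt, px)).2 - x₀ = -(s • px) := by simp
  rw [e1, e2, inner_neg_right, inner_smul_right, real_inner_self_eq_norm_sq] at hs
  have h3 := hw ((t₀, x₀) - s • (pt, px)).1 ((t₀, x₀) - s • (pt, px)).2
  have h4 : s * (pt ^ 2 + ‖px‖ ^ 2) ≤ s * (‖(pt, px)‖ ^ 2 / 2) := by nlinarith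
  have h5 := le_of_mul_le_mul_left h4 hs0
  have h6 : ‖(pt, px)‖ ^ 2 ≤ pt ^ 2 + ‖px‖ ^ 2 := by
    rw [Prod.norm_def]
    rcases max_choice ‖pt‖ ‖px‖ with h | h <;> simp only [h]
    · rw [Real.norm_eq_abs, sq_abs]; nlinarith [sq_nonneg ‖px‖]
    · nlinarith [sq_nonneg pt]
  nlinarith

/-- If the continuous function `v` is a viscosity subsolution of `−v_t + H(t,x,∇v) = 0`
on its strict zero-superlevel set `{(t,x) ∈ (0,T) × ℝⁿ | v(t,x) > 0}`, then the truncation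
`v_×(t,x) = max{v(t,x), 0}` is continuous and is a viscosity subsolution on all of
`(0,T) × ℝⁿ`, with terminal condition `v_×(T,x) = max{v(T,x), 0}`. -/
theorem truncation_is_subsolution {n m : ℕ} (T : ℝ) (hT : 0 < T)
    (U : Set (Fin m → ℝ)) (hUc : IsCompact U) (hUne : U.Nonempty)
    (f : ℝ → EuclideanSpace ℝ (Fin n) → (Fin m → ℝ) → EuclideanSpace ℝ (Fin n))
    (hfc : ContinuousOn
      (fun z : ℝ × EuclideanSpace ℝ (Fin n) × (Fin m → ℝ) => f z.1 z.2.1 z.2.2)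
      (Set.Icc 0 T ×ˢ (Set.univ : Set (EuclideanSpace ℝ (Fin n))) ×ˢ U))
    (L : ℝ) (hL : 0 ≤ L)
    (hfl : ∀ s ∈ Set.Icc (0 : ℝ) T, ∀ w ∈ U, ∀ x y : EuclideanSpace ℝ (Fin n),
      ‖f s x w - f s y w‖ ≤ L * ‖x - y‖)
    (H : ℝ → EuclideanSpace ℝ (Fin n) → EuclideanSpace ℝ (Fin n) → ℝ)
    (hH : ∀ t ∈ Set.Icc (0 : ℝ) T, ∀ x p,
      IsGreatest ((fun w => ⟪-p, f t x w⟫) '' U) (H t x p))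
    (v : ℝ → EuclideanSpace ℝ (Fin n) → ℝ)
    (hvc : ContinuousOn (fun z : ℝ × EuclideanSpace ℝ (Fin n) => v z.1 z.2)
      (Set.Icc 0 T ×ˢ (Set.univ : Set (EuclideanSpace ℝ (Fin n)))))
    (hsub : ∀ t₀ ∈ Set.Ioo (0 : ℝ) T, ∀ x₀, 0 < v t₀ x₀ →
      ∀ pt px, IsSupGrad v t₀ x₀ pt px → -pt + H t₀ x₀ px ≤ 0) :
    ContinuousOn (fun z : ℝ × EuclideanSpace ℝ (Fin n) => max (v z.1 z.2) 0)
      (Set.Icc 0 T ×ˢ (Set.univ : Set (EuclideanSpace ℝ (Fin n)))) ∧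
    (∀ t₀ ∈ Set.Ioo (0 : ℝ) T, ∀ x₀ pt px,
      IsSupGrad (fun t x => max (v t x) 0) t₀ x₀ pt px → -pt + H t₀ x₀ px ≤ 0) ∧
    (∀ x, max (v T x) 0 = max (v T x) 0) := by
  refine ⟨hvc.sup continuousOn_const, ?_, fun _ => rfl⟩
  intro t₀ ht₀ x₀ pt px hp
  rcases lt_or_ge 0 (v t₀ x₀) with hv | hv
  · apply hsub t₀ ht₀ x₀ hv
    intro ε hε
    filter_upwards [hp ε hε] with z hz
    have h1 : max (v t₀ x₀) 0 = v t₀ x₀ := max_eq_left hv.le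
    have h2 := le_max_left (v z.1 z.2) 0
    simp only [h1] at hz
    linarith
  · obtain ⟨rfl, rfl⟩ := supgrad_zero_aux _ t₀ x₀ pt px
      (fun t x => by simp only [max_eq_right hv]; exact le_max_right _ _) hp
    obtain ⟨w, -, hw⟩ := (hH t₀ (Ioo_subset_Icc_self ht₀) x₀ 0).1
    simp at hw
    simp [← hw]

end
end

section
/- Fix T > 0, let U ⊂ ℝᵐ be compact and nonempty, let f : [0,T] × ℝⁿ × U → ℝⁿ be continuous and Lipschitz continuous in x uniformly in (s,u), with f(s,x,U) convex for every (s,x). Let g : ℝⁿ → ℝ be continuous, set 𝒳 = {x | g(x) ≤ 0}, and let 𝒢(t) = {x ∈ ℝⁿ | ∃ measurable u : [t,T] → U with φ(T;t,x,u) ∈ 𝒳} be the backwards reachable set. Let v̄ : [0,T] × ℝⁿ → ℝ be continuous, a viscosity supersolution of −v_t + H(t,x,∇v) = 0 (with H(t,x,p) = max_{u∈U} ⟨−p, f(t,x,u)⟩) on the open set Ω = {(t,x) ∈ (0,T) × ℝⁿ | v̄(t,x) < 0}, with terminal condition v̄(T,x) = ḡ(x) for all x. If x ↦ v̄(t,x)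 is of class Z for every t ∈ [0,T] and ḡ(x) > 0 for every x ∉ 𝒳, then for every t ∈ [0,T] the set {x ∈ ℝⁿ | v̄(t,x) ≤ 0} is contained in 𝒢(t). -/
open scoped RealInnerProductSpace
open Set

noncomputable section

/-- The backwards reachable set at time `t` of the target `{g ≤ 0}` at time `T`. -/
def Reach {n m : ℕ} (U : Set (Fin m → ℝ))
    (f : ℝ → EuclideanSpace ℝ (Fin n) → (Fin m → ℝ) → EuclideanSpace ℝ (Fin n))
    (g : EuclideanSpace ℝ (Fin n) → ℝ) (T t : ℝ) : Set (EuclideanSpace ℝ (Fin n)) :=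
  {x | ∃ u X, Admissible U t T u ∧ IsTraj f t T x u X ∧ g (X T) ≤ 0}

/-- `(pt, px)` is a Fréchet subgradient of `w` at `(t₀, x₀)`:
the liminf as `(t,x) → (t₀,x₀)` of
`[w(t,x) − w(t₀,x₀) − ⟨(pt,px), (t,x) − (t₀,x₀)⟩]/‖(t,x) − (t₀,x₀)‖` is nonnegative. -/
def IsSubGrad {n : ℕ} (w : ℝ → EuclideanSpace ℝ (Fin n) → ℝ) (t₀ : ℝ)
    (x₀ : EuclideanSpace ℝ (Fin n)) (pt : ℝ) (px : EuclideanSpace ℝ (Fin n)) : Prop :=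
  ∀ ε : ℝ, 0 < ε →
    ∀ᶠ z : ℝ × EuclideanSpace ℝ (Fin n) in nhdsWithin (t₀, x₀) {(t₀, x₀)}ᶜ,
      -(ε * ‖(z.1 - t₀, z.2 - x₀)‖) ≤
        w z.1 z.2 - w t₀ x₀ - (pt * (z.1 - t₀) + ⟪px, z.2 - x₀⟫)


lemma aux_meas_exists {D : Set ℝ} (hD : IsCompact D) (ψ : ℝ → ℝ → ℝ)
    (hpos : ∀ s θ, 0 ≤ ψ s θ)
    (hm : ∀ θ ∈ D, Measurable fun s => ψ s θ) (hc : ∀ s, ContinuousOn (ψ s) D) :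
    MeasurableSet {s | ∃ θ ∈ D, ψ s θ = 0} := by
  obtain ⟨c, hcc, hcd⟩ := TopologicalSpace.exists_countable_dense D
  have : {s | ∃ θ ∈ D, ψ s θ = 0} = ⋂ k : ℕ, ⋃ d ∈ c, {s | ψ s (d : ℝ) < 1 / ((k : ℝ) + 1)} := by
    ext s
    simp only [mem_ofPred_eq, mem_iInter, mem_iUnion]
    have hcs : Continuous fun d : D => ψ s d := (hc s).domRestrict
    constructor
    · rintro ⟨θ, hθ, h0⟩ k
      have ho : IsOpen {d : D | ψ s d < 1 / ((k : ℝ) + 1)} := isOpen_lt hcs continuous_const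
      obtain ⟨d, hd1, hd2⟩ := hcd.inter_open_nonempty _ ho
        ⟨⟨θ, hθ⟩, by simp only [mem_ofPred_eq, h0]; positivity⟩
      exact ⟨d, hd2, hd1⟩
    · intro h
      have hne : D.Nonempty := by
        obtain ⟨d, -, -⟩ := h 0
        exact ⟨d, d.2⟩
      obtain ⟨θ, hθ, hmin⟩ := hD.exists_isMinOn hne (hc s)
      refine ⟨θ, hθ, le_antisymm ?_ (hpos _ _)⟩
      refine le_of_forall_pos_le_add fun ε hε => ?_
      obtain ⟨k, hk⟩ := exists_nat_one_div_lt hε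
      obtain ⟨d, -, hd⟩ := h k
      have := hmin d.2
      simp only [mem_ofPred_eq] at this
      linarith
  rw [this]
  refine MeasurableSet.iInter fun k => MeasurableSet.biUnion hcc fun d _ => ?_
  exact measurableSet_lt (hm d d.2) measurable_const

lemma aux_select {D : Set ℝ} (hD : IsCompact D) (θ₀ : ℝ) (hθ₀ : θ₀ ∈ D) (ψ : ℝ → ℝ → ℝ)
    (hpos : ∀ s θ, 0 ≤ ψ s θ)
    (hm : ∀ θ ∈ D, Measurable fun s => ψ s θ) (hc : ∀ s, ContinuousOn (ψ s) D) :
    ∃ τ : ℝ → ℝ, Measurable τ ∧ (∀ s, τ s ∈ D) ∧ ∀ s, (∃ θ ∈ D, ψ s θ = 0) → ψ s (τ s) = 0 := by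
  classical
  set A : ℝ → Set ℝ := fun s => {θ | θ ∈ D ∧ ψ s θ = 0} with hA
  have hAc : ∀ s, IsCompact (A s) := by
    intro s
    have : A s = D ∩ ψ s ⁻¹' {0} := by ext; simp [hA]
    rw [this]
    exact hD.of_isClosed_subset ((hc s).preimage_isClosed_of_isClosed hD.isClosed isClosed_singleton)
      inter_subset_left
  set P : Set ℝ := {s | ∃ θ ∈ D, ψ s θ = 0} with hP
  have hPm : MeasurableSet P := aux_meas_exists hD ψ hpos hm hc
  have hin : ∀ s ∈ P, sInf (A s) ∈ A s := by
    rintro s ⟨θ, h1, h2⟩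
    exact (hAc s).sInf_mem ⟨θ, h1, h2⟩
  refine ⟨fun s => if s ∈ P then sInf (A s) else θ₀, ?_, ?_, ?_⟩
  · refine measurable_of_Iic fun a => ?_
    have : (fun s => if s ∈ P then sInf (A s) else θ₀) ⁻¹' Iic a =
        {s | ∃ θ ∈ D ∩ Iic a, ψ s θ = 0} ∪ (Pᶜ ∩ {s | θ₀ ≤ a}) := by
      ext s
      simp only [mem_preimage, mem_Iic, mem_union, mem_ofPred_eq, mem_inter_iff, mem_compl_iff]
      by_cases hs : s ∈ P
      · simp only [hs, if_true, not_true, false_and, or_false]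
        constructor
        · intro h
          exact ⟨_, ⟨(hin s hs).1, h⟩, (hin s hs).2⟩
        · rintro ⟨θ, ⟨h1, h2⟩, h3⟩
          exact (csInf_le (hAc s).bddBelow ⟨h1, h3⟩).trans h2
      · simp only [hs, if_false, not_false_eq_true, true_and]
        constructor
        · exact Or.inr
        · rintro (⟨θ, ⟨h1, h2⟩, h3⟩ | h)
          · exact absurd ⟨θ, h1, h3⟩ hs
          · exact h
    rw [this]
    refine (aux_meas_exists (hD.inter_right isClosed_Iic) ψ hpos (fun θ h => hm θ h.1)
      fun s => (hc s).mono inter_subset_left).union (hPm.compl.inter (MeasurableSet.const _))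
  · intro s
    by_cases hs : s ∈ P
    · simp only [hs, if_true]; exact (hin s hs).1
    · simp only [hs, if_false]; exact hθ₀
  · intro s hs
    have hs' : s ∈ P := hs
    simp only [hs', if_true]; exact (hin s hs').2

lemma aux_filippov {m : ℕ} {E : Type*} [NormedAddCommGroup E] [MeasurableSpace E] [BorelSpace E]
    [SecondCountableTopology E]
    (U : Set (Fin m → ℝ)) (hUc : IsCompact U) (hUne : U.Nonempty)
    (F : ℝ → (Fin m → ℝ) → E) (Y : ℝ → E) (hY : Measurable Y)
    (hm : ∀ w ∈ U, Measurable fun s => F s w) (hc : ∀ s, ContinuousOn (F s) U) :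
    ∃ u : ℝ → (Fin m → ℝ), Measurable u ∧ (∀ s, u s ∈ U) ∧
      ∀ s, Y s ∈ F s '' U → F s (u s) = Y s := by
  have : Nonempty U := hUne.to_subtype
  have : CompactSpace U := isCompact_iff_compactSpace.1 hUc
  obtain ⟨c₀, hc₀, hs₀⟩ := exists_nat_bool_continuous_surjective_of_compact U
  set c : cantorSet → U := fun θ => c₀ (cantorSetHomeomorphNatToBool θ) with hcdef
  have hcc : Continuous c := hc₀.comp cantorSetHomeomorphNatToBool.continuous
  have hcs : Function.Surjective c := hs₀.comp cantorSetHomeomorphNatToBool.surjective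
  classical
  set ψ : ℝ → ℝ → ℝ := fun s θ => if h : θ ∈ cantorSet then ‖F s (c ⟨θ, h⟩) - Y s‖ else 0 with hψ
  have e : ∀ s (θ : cantorSet), ψ s θ = ‖F s (c θ) - Y s‖ := by
    intro s θ; simp [hψ, θ.2]
  obtain ⟨τ, h1, h2, h3⟩ := aux_select isCompact_cantorSet 0 zero_mem_cantorSet ψ
    (by intro s θ; simp only [hψ]; split_ifs <;> positivity)
    (by
      intro θ hθ
      have : (fun s => ψ s θ) = fun s => ‖F s (c ⟨θ, hθ⟩) - Y s‖ := by
        ext s; exact e s ⟨θ, hθ⟩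
      rw [this]
      exact ((hm _ (c ⟨θ, hθ⟩).2).sub hY).norm)
    (by
      intro s
      rw [continuousOn_iff_continuous_domRestrict]
      have : cantorSet.domRestrict (ψ s) = fun θ : cantorSet => ‖F s (c θ) - Y s‖ := by
        ext θ; exact e s θ
      rw [this]
      have h := (hc s).domRestrict.comp hcc
      exact (h.sub continuous_const).norm)
  refine ⟨fun s => c ⟨τ s, h2 s⟩, ?_, fun s => (c _).2, ?_⟩
  · exact measurable_subtype_coe.comp (hcc.measurable.comp (h1.subtype_mk))
  · rintro s ⟨w, hw, hwe⟩
    obtain ⟨θ, hθ⟩ := hcs ⟨w, hw⟩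
    have := h3 s ⟨θ, θ.2, by rw [e, hθ]; simp [hwe]⟩
    have h4 := e s ⟨τ s, h2 s⟩
    simp only at h4
    rw [this] at h4
    exact sub_eq_zero.1 (norm_eq_zero.1 h4.symm)

lemma aux_ftc {n : ℕ} (X : ℝ → EuclideanSpace ℝ (Fin n)) (K : NNReal) (hX : LipschitzWith K X)
    (a b : ℝ) : X b = X a + ∫ r in a..b, deriv X r := by
  have hd := hX.ae_differentiableAt_real
  have hint : IntervalIntegrable (deriv X) MeasureTheory.volume a b := by
    refine (intervalIntegrable_const (c := (K : ℝ))).mono_fun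
      (measurable_deriv X).aestronglyMeasurable ?_
    filter_upwards with s
    simpa using norm_deriv_le_of_lipschitz hX
  rw [← sub_eq_iff_eq_add']
  ext i
  have h1 : (∫ r in a..b, deriv X r) i = ∫ r in a..b, (deriv X r) i := by
    have := (EuclideanSpace.proj i : EuclideanSpace ℝ (Fin n) →L[ℝ] ℝ).intervalIntegral_comp_comm hint
    simpa using this.symm
  have hXi : LipschitzWith K fun s => X s i := by
    refine LipschitzWith.of_dist_le_mul fun x y => ?_
    refine le_trans ?_ (hX.dist_le_mul x y)
    rw [dist_eq_norm, dist_eq_norm]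
    simpa using PiLp.norm_apply_le (X x - X y) i
  have h2 := (hXi.lipschitzOnWith (s := uIcc a b)).absolutelyContinuousOnInterval.integral_deriv_eq_sub
  rw [h1, PiLp.sub_apply, ← h2]
  refine intervalIntegral.integral_congr_ae ?_
  filter_upwards [hd] with s hs _
  have := (EuclideanSpace.proj i : EuclideanSpace ℝ (Fin n) →L[ℝ] ℝ).hasFDerivAt.comp_hasDerivAt s hs.hasDerivAt
  exact this.deriv

/-- the one-sided support-function inequality of a curve. -/
def SuppProp {n m : ℕ} (U : Set (Fin m → ℝ))
    (f : ℝ → EuclideanSpace ℝ (Fin n) → (Fin m → ℝ) → EuclideanSpace ℝ (Fin n))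
    (T t M : ℝ) (X : ℝ → EuclideanSpace ℝ (Fin n)) : Prop :=
  ∀ η : ℝ, 0 < η → ∀ a b : ℝ, t < a → a < b → b < T → ∀ (p : EuclideanSpace ℝ (Fin n)) (c : ℝ),
    (∀ r ∈ Icc (0 : ℝ) T, a - η ≤ r → r ≤ b + η → ∀ y, ‖y - X a‖ ≤ M * (b - a) + η →
      ∀ w ∈ U, ⟪p, f r y w⟫ ≤ c) → ⟪p, X b - X a⟫ ≤ c * (b - a)

lemma aux_fproj_cont {n m : ℕ} (T : ℝ) (hT : 0 < T)
    (U : Set (Fin m → ℝ))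
    (f : ℝ → EuclideanSpace ℝ (Fin n) → (Fin m → ℝ) → EuclideanSpace ℝ (Fin n))
    (hfc : ContinuousOn
      (fun z : ℝ × EuclideanSpace ℝ (Fin n) × (Fin m → ℝ) => f z.1 z.2.1 z.2.2)
      (Set.Icc 0 T ×ˢ (Set.univ : Set (EuclideanSpace ℝ (Fin n))) ×ˢ U)) :
    Continuous fun z : (ℝ × EuclideanSpace ℝ (Fin n)) × U =>
      f (projIcc 0 T hT.le z.1.1) z.1.2 z.2 := by
  have hg : Continuous fun z : (ℝ × EuclideanSpace ℝ (Fin n)) × U =>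
      (((projIcc 0 T hT.le z.1.1 : ℝ), z.1.2, (z.2 : Fin m → ℝ)) :
        ℝ × EuclideanSpace ℝ (Fin n) × (Fin m → ℝ)) := by
    refine Continuous.prodMk ?_ (Continuous.prodMk ?_ ?_)
    · exact continuous_subtype_val.comp (continuous_projIcc.comp (continuous_fst.comp continuous_fst))
    · fun_prop
    · fun_prop
  exact hfc.comp_continuous hg fun z => ⟨(projIcc 0 T hT.le z.1.1).2, mem_univ _, z.2.2⟩

lemma aux_deriv_mem {n m : ℕ} (T : ℝ) (hT : 0 < T)
    (U : Set (Fin m → ℝ)) (hUc : IsCompact U)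
    (f : ℝ → EuclideanSpace ℝ (Fin n) → (Fin m → ℝ) → EuclideanSpace ℝ (Fin n))
    (hfc : ContinuousOn
      (fun z : ℝ × EuclideanSpace ℝ (Fin n) × (Fin m → ℝ) => f z.1 z.2.1 z.2.2)
      (Set.Icc 0 T ×ˢ (Set.univ : Set (EuclideanSpace ℝ (Fin n))) ×ˢ U))
    (hconv : ∀ s ∈ Set.Icc (0 : ℝ) T, ∀ x, Convex ℝ ((f s x) '' U))
    (t M : ℝ) (ht : 0 ≤ t) (hM : 0 ≤ M) (X : ℝ → EuclideanSpace ℝ (Fin n))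
    (hS : SuppProp U f T t M X) (s : ℝ) (hs : s ∈ Ioo t T) (hd : DifferentiableAt ℝ X s) :
    deriv X s ∈ f s (X s) '' U := by
  by_contra hnot
  have hs0 : s ∈ Icc (0 : ℝ) T := ⟨ht.trans hs.1.le, hs.2.le⟩
  have hF := aux_fproj_cont T hT U f hfc
  have : CompactSpace U := isCompact_iff_compactSpace.1 hUc
  have hcs : ContinuousOn (f s (X s)) U := by
    refine hfc.comp (f := fun w => (s, X s, w)) (by fun_prop) fun w hw => ⟨hs0, mem_univ _, hw⟩
  have hK : IsCompact (f s (X s) '' U) := hUc.image_of_continuousOn hcs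
  obtain ⟨φ, c, h1, h2⟩ := geometric_hahn_banach_closed_point (hconv s hs0 (X s)) hK.isClosed hnot
  have hev : ∀ᶠ q : ℝ × EuclideanSpace ℝ (Fin n) in nhds (s, X s), ∀ w ∈ (univ : Set U),
      φ (f (projIcc 0 T hT.le q.1) q.2 w) < c := by
    refine isCompact_univ.eventually_forall_of_forall_eventually fun w _ => ?_
    have hc2 : Continuous fun z : (ℝ × EuclideanSpace ℝ (Fin n)) × U =>
      φ (f (projIcc 0 T hT.le z.1.1) z.1.2 z.2) := φ.continuous.comp hF
    refine hc2.continuousAt.eventually_lt continuousAt_const ?_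
    simp only [projIcc_of_mem hT.le hs0]
    exact h1 _ ⟨w, w.2, rfl⟩
  obtain ⟨δ, hδ, hball⟩ := Metric.eventually_nhds_iff.1 hev
  have hlim := hd.hasDerivAt.tendsto_slope_zero_right
  have hlim2 := (φ.continuous.tendsto _).comp hlim
  refine absurd (le_of_tendsto hlim2 ?_) (not_le.2 h2)
  have hsmall : ∀ᶠ h in nhdsWithin (0 : ℝ) (Ioi 0), 0 < h ∧ h < δ / 4 ∧ M * h < δ / 4 ∧ s + h < T := by
    refine Filter.Eventually.and self_mem_nhdsWithin (Filter.Eventually.filter_mono nhdsWithin_le_nhds ?_)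
    refine (Filter.Tendsto.eventually_lt_const (by positivity) (continuous_id.tendsto' 0 0 rfl)).and
     ((Filter.Tendsto.eventually_lt_const (v := 0) (by positivity) (Continuous.tendsto' (by fun_prop) _ _ (by simp))).and
      (Filter.Tendsto.eventually_lt_const (v := s) hs.2 (Continuous.tendsto' (by fun_prop) _ _ (by simp))))
  filter_upwards [hsmall] with h ⟨h0, hh1, hh2, hh3⟩
  have hp : ∀ y, ⟪(InnerProductSpace.toDual ℝ (EuclideanSpace ℝ (Fin n))).symm φ, y⟫ = φ y := by
    intro y; simp
  have key := hS (δ / 4) (by positivity) s (s + h) hs.1 (by linarith) hh3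
    ((InnerProductSpace.toDual ℝ (EuclideanSpace ℝ (Fin n))).symm φ) c (by
      intro r hr hr1 hr2 y hy w hw
      rw [hp]
      have := @hball (r, y) (by
        rw [Prod.dist_eq, max_lt_iff]
        constructor
        · simp only [Real.dist_eq]; rw [abs_lt]; constructor <;> linarith
        · simp only [dist_eq_norm]; 
          have : M * (s + h - s) = M * h := by ring
          linarith) ⟨w, hw⟩ (mem_univ _)
      simp only [projIcc_of_mem hT.le hr] at this
      exact this.le)
  rw [hp] at key
  simp only [Function.comp, map_smul, smul_eq_mul]
  rw [inv_mul_le_iff₀ h0]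
  linarith [key]

lemma aux_traj {n m : ℕ} (T : ℝ) (hT : 0 < T)
    (U : Set (Fin m → ℝ)) (hUc : IsCompact U) (hUne : U.Nonempty)
    (f : ℝ → EuclideanSpace ℝ (Fin n) → (Fin m → ℝ) → EuclideanSpace ℝ (Fin n))
    (hfc : ContinuousOn
      (fun z : ℝ × EuclideanSpace ℝ (Fin n) × (Fin m → ℝ) => f z.1 z.2.1 z.2.2)
      (Set.Icc 0 T ×ˢ (Set.univ : Set (EuclideanSpace ℝ (Fin n))) ×ˢ U))
    (hconv : ∀ s ∈ Set.Icc (0 : ℝ) T, ∀ x, Convex ℝ ((f s x) '' U))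
    (t M : ℝ) (ht : 0 ≤ t) (hM : 0 ≤ M) (X : ℝ → EuclideanSpace ℝ (Fin n))
    (hXL : ∀ a b, a ≤ b → ‖X b - X a‖ ≤ M * (b - a))
    (hS : SuppProp U f T t M X) :
    ∃ u, Admissible U t T u ∧ IsTraj f t T (X t) u X := by
  have hLip : LipschitzWith ⟨M, hM⟩ X := by
    refine LipschitzWith.of_dist_le_mul fun a b => ?_
    rw [dist_eq_norm, dist_eq_norm]
    simp only [NNReal.coe_mk, Real.norm_eq_abs]
    rcases le_total a b with h | h
    · rw [norm_sub_rev, abs_sub_comm, abs_of_nonneg (by linarith : (0:ℝ) ≤ b - a)]; exact hXL a b h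
    · rw [abs_of_nonneg (by linarith : (0:ℝ) ≤ a - b)]; exact hXL b a h
  have hF := aux_fproj_cont T hT U f hfc
  have hXc := hLip.continuous
  obtain ⟨u, hu1, hu2, hu3⟩ := aux_filippov U hUc hUne
    (fun s w => f (projIcc 0 T hT.le s) (X s) w) (deriv X) (measurable_deriv X)
    (by
      intro w hw
      have : Continuous fun s => f (projIcc 0 T hT.le s) (X s) w :=
        hF.comp (f := fun s : ℝ => ((s, X s), (⟨w, hw⟩ : U))) (by fun_prop)
      exact this.measurable)
    (by
      intro s
      rw [continuousOn_iff_continuous_domRestrict]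
      exact hF.comp (f := fun w : U => ((s, X s), w)) (by fun_prop))
  refine ⟨u, ⟨hu1, fun s _ => hu2 s⟩, hXc.continuousOn, fun s hs => ?_⟩
  rw [aux_ftc X _ hLip t s]
  congr 1
  refine intervalIntegral.integral_congr_ae ?_
  have hne : ∀ᵐ r : ℝ, r ≠ T := by
    simp [MeasureTheory.ae_iff]
  filter_upwards [hLip.ae_differentiableAt_real, hne] with r hr hrT hrm
  rw [uIoc_of_le hs.1] at hrm
  have hr1 : r ∈ Ioo t T := ⟨hrm.1, lt_of_le_of_ne (hrm.2.trans hs.2) hrT⟩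
  have hr0 : r ∈ Icc (0 : ℝ) T := ⟨ht.trans hr1.1.le, hr1.2.le⟩
  have h1 := aux_deriv_mem T hT U hUc f hfc hconv t M ht hM X hS r hr1 hr
  have h2 := hu3 r (by simpa only [projIcc_of_mem hT.le hr0] using h1)
  simp only [projIcc_of_mem hT.le hr0] at h2
  exact h2.symm

lemma aux_W {n : ℕ} (T : ℝ) (hT : 0 < T) (vbar : ℝ → EuclideanSpace ℝ (Fin n) → ℝ)
    (hvc : ContinuousOn (fun z : ℝ × EuclideanSpace ℝ (Fin n) => vbar z.1 z.2)
      (Set.Icc 0 T ×ˢ (Set.univ : Set (EuclideanSpace ℝ (Fin n))))) (κ R : ℝ) (hR : 0 ≤ R) :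
    ∃ W : ℝ → EuclideanSpace ℝ (Fin n) → ℝ,
      (∀ t x, ∀ s ∈ Icc (0 : ℝ) T, ∀ y, ‖y‖ ≤ R + 1 →
        W t x ≤ vbar s y + κ * ((t - s) ^ 2 + ‖x - y‖ ^ 2)) ∧
      (∀ t x, ∃ s ∈ Icc (0 : ℝ) T, ∃ y, ‖y‖ ≤ R + 1 ∧
        W t x = vbar s y + κ * ((t - s) ^ 2 + ‖x - y‖ ^ 2)) := by
  have hK : IsCompact (Icc (0 : ℝ) T ×ˢ Metric.closedBall (0 : EuclideanSpace ℝ (Fin n)) (R + 1)) :=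
    isCompact_Icc.prod (isCompact_closedBall _ _)
  have hne : (Icc (0 : ℝ) T ×ˢ Metric.closedBall (0 : EuclideanSpace ℝ (Fin n)) (R + 1)).Nonempty :=
    ⟨(0, 0), ⟨le_rfl, hT.le⟩, by simp; linarith⟩
  have : ∀ (t : ℝ) (x : EuclideanSpace ℝ (Fin n)), ∃ W : ℝ, (∀ s ∈ Icc (0 : ℝ) T, ∀ y, ‖y‖ ≤ R + 1 →
        W ≤ vbar s y + κ * ((t - s) ^ 2 + ‖x - y‖ ^ 2)) ∧
      (∃ s ∈ Icc (0 : ℝ) T, ∃ y, ‖y‖ ≤ R + 1 ∧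
        W = vbar s y + κ * ((t - s) ^ 2 + ‖x - y‖ ^ 2)) := by
    intro t x
    have hc : ContinuousOn (fun z : ℝ × EuclideanSpace ℝ (Fin n) =>
        vbar z.1 z.2 + κ * ((t - z.1) ^ 2 + ‖x - z.2‖ ^ 2))
        (Icc (0 : ℝ) T ×ˢ Metric.closedBall (0 : EuclideanSpace ℝ (Fin n)) (R + 1)) :=
      (hvc.mono (prod_mono le_rfl (subset_univ _))).add (by fun_prop)
    obtain ⟨⟨s, y⟩, hz, hmin⟩ := hK.exists_isMinOn hne hc
    refine ⟨vbar s y + κ * ((t - s) ^ 2 + ‖x - y‖ ^ 2), fun s' hs' y' hy' => ?_,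
      s, hz.1, y, by simpa using hz.2, rfl⟩
    exact hmin (a := (s', y')) ⟨hs', by simpa using hy'⟩
  choose W h1 h2 using this
  exact ⟨W, h1, h2⟩

lemma aux_near {n : ℕ} (κ ε B R T : ℝ) (hκ : 0 < κ) (hε : 0 < ε)
    (vbar W : ℝ → EuclideanSpace ℝ (Fin n) → ℝ)
    (hB : ∀ s ∈ Icc (0 : ℝ) T, ∀ y, ‖y‖ ≤ R + 1 → |vbar s y| ≤ B) (hκB : 2 * B ≤ κ * ε ^ 2)
    (hWle : ∀ t x, ∀ s ∈ Icc (0 : ℝ) T, ∀ y, ‖y‖ ≤ R + 1 →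
        W t x ≤ vbar s y + κ * ((t - s) ^ 2 + ‖x - y‖ ^ 2))
    (t : ℝ) (x : EuclideanSpace ℝ (Fin n)) (ht : t ∈ Icc (0 : ℝ) T) (hx : ‖x‖ ≤ R)
    (s : ℝ) (y : EuclideanSpace ℝ (Fin n)) (hs : s ∈ Icc (0 : ℝ) T) (hy : ‖y‖ ≤ R + 1)
    (he : W t x = vbar s y + κ * ((t - s) ^ 2 + ‖x - y‖ ^ 2)) :
    |t - s| ≤ ε ∧ ‖x - y‖ ≤ ε := by
  have h1 := hWle t x t ht x (by linarith)
  have h2 := (abs_le.1 (hB t ht x (by linarith))).2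
  have h3 := (abs_le.1 (hB s hs y hy)).1
  simp only [sub_self, norm_zero] at h1
  have h4 : κ * ((t - s) ^ 2 + ‖x - y‖ ^ 2) ≤ κ * ε ^ 2 := by
    have : κ * (0 ^ 2 + 0 ^ 2) = (0 : ℝ) := by ring
    linarith
  have h5 := le_of_mul_le_mul_left h4 hκ
  constructor
  · exact abs_le_of_sq_le_sq (by nlinarith [sq_nonneg ‖x - y‖]) hε.le
  · exact le_of_sq_le_sq (by nlinarith [sq_nonneg (t - s)]) hε.le

lemma aux_step {n m : ℕ} (T : ℝ)
    (U : Set (Fin m → ℝ))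
    (f : ℝ → EuclideanSpace ℝ (Fin n) → (Fin m → ℝ) → EuclideanSpace ℝ (Fin n))
    (H : ℝ → EuclideanSpace ℝ (Fin n) → EuclideanSpace ℝ (Fin n) → ℝ)
    (hH : ∀ t ∈ Set.Icc (0 : ℝ) T, ∀ x p,
      IsGreatest ((fun w => ⟪-p, f t x w⟫) '' U) (H t x p))
    (vbar : ℝ → EuclideanSpace ℝ (Fin n) → ℝ)
    (hsuper : ∀ t₀ ∈ Set.Ioo (0 : ℝ) T, ∀ x₀, vbar t₀ x₀ < 0 →
      ∀ pt px, IsSubGrad vbar t₀ x₀ pt px → 0 ≤ -pt + H t₀ x₀ px)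
    (κ ε B R : ℝ) (hκ : 0 < κ) (hε : 0 < ε) (hε1 : ε < 1)
    (W : ℝ → EuclideanSpace ℝ (Fin n) → ℝ)
    (hB : ∀ s ∈ Icc (0 : ℝ) T, ∀ y, ‖y‖ ≤ R + 1 → |vbar s y| ≤ B) (hκB : 2 * B ≤ κ * ε ^ 2)
    (hWle : ∀ t x, ∀ s ∈ Icc (0 : ℝ) T, ∀ y, ‖y‖ ≤ R + 1 →
        W t x ≤ vbar s y + κ * ((t - s) ^ 2 + ‖x - y‖ ^ 2))
    (hWex : ∀ t x, ∃ s ∈ Icc (0 : ℝ) T, ∃ y, ‖y‖ ≤ R + 1 ∧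
        W t x = vbar s y + κ * ((t - s) ^ 2 + ‖x - y‖ ^ 2))
    (t : ℝ) (x : EuclideanSpace ℝ (Fin n)) (ht : ε < t) (htT : t < T - ε) (hx : ‖x‖ ≤ R)
    (hneg : W t x < 0) :
    ∃ s ∈ Icc (0 : ℝ) T, |t - s| ≤ ε ∧ ∃ y, ‖x - y‖ ≤ ε ∧ ∃ w ∈ U, ∀ h : ℝ, 0 ≤ h →
      W (t + h) (x + h • f s y w) ≤ W t x + κ * h ^ 2 * (1 + ‖f s y w‖ ^ 2) := by
  obtain ⟨s, hs, y, hy, he⟩ := hWex t x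
  obtain ⟨hn1, hn2⟩ := aux_near κ ε B R T hκ hε vbar W hB hκB hWle t x
    ⟨by linarith, by linarith⟩ hx s y hs hy he
  have hsI : s ∈ Ioo (0 : ℝ) T := by
    obtain ⟨h1, h2⟩ := abs_le.1 hn1
    constructor <;> linarith
  have hyI : ‖y‖ < R + 1 := by
    have : ‖y‖ ≤ ‖x‖ + ‖x - y‖ := by
      have := norm_sub_le x (x - y)
      simpa using this
    linarith
  have hvneg : vbar s y < 0 := by
    have : 0 ≤ κ * ((t - s) ^ 2 + ‖x - y‖ ^ 2) := by positivity
    linarith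
  have hsub : IsSubGrad vbar s y (2 * κ * (t - s)) ((2 * κ) • (x - y)) := by
    intro δ hδ
    refine Filter.Eventually.filter_mono nhdsWithin_le_nhds ?_
    have e1 : ∀ᶠ z : ℝ × EuclideanSpace ℝ (Fin n) in nhds (s, y), z.1 ∈ Ioo (0 : ℝ) T :=
      continuous_fst.continuousAt.eventually_mem (isOpen_Ioo.mem_nhds hsI)
    have e2 : ∀ᶠ z : ℝ × EuclideanSpace ℝ (Fin n) in nhds (s, y), ‖z.2‖ < R + 1 :=
      (continuous_snd.norm.continuousAt).eventually_lt continuousAt_const hyI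
    have e3 : ∀ᶠ z : ℝ × EuclideanSpace ℝ (Fin n) in nhds (s, y),
        2 * κ * ‖(z.1 - s, z.2 - y)‖ < δ := by
      refine ContinuousAt.eventually_lt (by fun_prop) continuousAt_const ?_
      simpa using hδ
    filter_upwards [e1, e2, e3] with z h1 h2 h3
    have hw := hWle t x z.1 ⟨h1.1.le, h1.2.le⟩ z.2 h2.le
    set q := ‖(z.1 - s, z.2 - y)‖ with hq
    have q0 : 0 ≤ q := norm_nonneg _
    have q1 : |z.1 - s| ≤ q := norm_fst_le (z.1 - s, z.2 - y)
    have q2 : ‖z.2 - y‖ ≤ q := norm_snd_le (z.1 - s, z.2 - y)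
    have q1' : (z.1 - s) ^ 2 ≤ q ^ 2 := by rw [← sq_abs]; gcongr
    have q2' : ‖z.2 - y‖ ^ 2 ≤ q ^ 2 := by gcongr
    have hexp : ‖x - z.2‖ ^ 2 = ‖x - y‖ ^ 2 - 2 * ⟪x - y, z.2 - y⟫ + ‖z.2 - y‖ ^ 2 := by
      rw [← norm_sub_sq_real]; congr 2; abel
    rw [inner_smul_left]
    simp only [conj_trivial]
    have q3 : κ * ((z.1 - s) ^ 2 + ‖z.2 - y‖ ^ 2) ≤ δ * q := by
      calc κ * ((z.1 - s) ^ 2 + ‖z.2 - y‖ ^ 2) ≤ κ * (q ^ 2 + q ^ 2) := by gcongr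
        _ = (2 * κ * q) * q := by ring
        _ ≤ δ * q := by gcongr
    rw [hexp] at hw
    have : κ * ((t - z.1) ^ 2 + (‖x - y‖ ^ 2 - 2 * ⟪x - y, z.2 - y⟫ + ‖z.2 - y‖ ^ 2))
      = κ * ((t - s) ^ 2 + ‖x - y‖ ^ 2) - (2 * κ * (t - s) * (z.1 - s) + 2 * κ * ⟪x - y, z.2 - y⟫)
        + κ * ((z.1 - s) ^ 2 + ‖z.2 - y‖ ^ 2) := by ring
    linarith
  have hvs := hsuper s hsI y hvneg _ _ hsub
  obtain ⟨w, hw, hwe⟩ := (hH s hs y ((2 * κ) • (x - y))).1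
  refine ⟨s, hs, hn1, y, hn2, w, hw, fun h hh => ?_⟩
  have h1 := hWle (t + h) (x + h • f s y w) s hs y hy
  simp only [inner_neg_left, inner_smul_left, conj_trivial] at hwe
  have hexp : ‖x + h • f s y w - y‖ ^ 2 = ‖x - y‖ ^ 2 + 2 * (h * ⟪x - y, f s y w⟫) + h ^ 2 * ‖f s y w‖ ^ 2 := by
    have : x + h • f s y w - y = (x - y) + h • f s y w := by abel
    rw [this, norm_add_sq_real, inner_smul_right, norm_smul, mul_pow, Real.norm_eq_abs, sq_abs]
  rw [hexp] at h1
  have h2 : 0 ≤ h * (-(2 * κ * (t - s)) - 2 * κ * ⟪x - y, f s y w⟫) :=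
    mul_nonneg hh (by linarith)
  rw [he]
  nlinarith [h1, h2]

lemma aux_seq {n m : ℕ} (T : ℝ) (hT : 0 < T)
    (U : Set (Fin m → ℝ))
    (f : ℝ → EuclideanSpace ℝ (Fin n) → (Fin m → ℝ) → EuclideanSpace ℝ (Fin n))
    (H : ℝ → EuclideanSpace ℝ (Fin n) → EuclideanSpace ℝ (Fin n) → ℝ)
    (hH : ∀ t ∈ Set.Icc (0 : ℝ) T, ∀ x p,
      IsGreatest ((fun w => ⟪-p, f t x w⟫) '' U) (H t x p))
    (vbar : ℝ → EuclideanSpace ℝ (Fin n) → ℝ)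
    (hvc : ContinuousOn (fun z : ℝ × EuclideanSpace ℝ (Fin n) => vbar z.1 z.2)
      (Set.Icc 0 T ×ˢ (Set.univ : Set (EuclideanSpace ℝ (Fin n)))))
    (hsuper : ∀ t₀ ∈ Set.Ioo (0 : ℝ) T, ∀ x₀, vbar t₀ x₀ < 0 →
      ∀ pt px, IsSubGrad vbar t₀ x₀ pt px → 0 ≤ -pt + H t₀ x₀ px)
    (C M R ρ : ℝ) (hC : 0 ≤ C) (hR : 0 ≤ R) (hρ : 0 ≤ ρ)
    (hRρ : (2 + ρ) * Real.exp (C * T) ≤ R)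
    (hfC : ∀ s ∈ Icc (0 : ℝ) T, ∀ y, ∀ w ∈ U, ‖f s y w‖ ≤ C * (1 + ‖y‖))
    (hfM : ∀ s ∈ Icc (0 : ℝ) T, ∀ y, ‖y‖ ≤ R + 1 → ∀ w ∈ U, ‖f s y w‖ ≤ M)
    (t₀ : ℝ) (ht₀ : t₀ ∈ Ioo (0 : ℝ) T) (x₀ : EuclideanSpace ℝ (Fin n)) (hx₀ : ‖x₀‖ ≤ ρ)
    (hneg : vbar t₀ x₀ < 0) (η : ℝ) (hη : 0 < η) :
    ∃ (N : ℕ) (h : ℝ) (x F : ℕ → EuclideanSpace ℝ (Fin n)), 0 < h ∧ h ≤ η ∧ t₀ + N * h ≤ T ∧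
      T - η ≤ t₀ + N * h ∧ x 0 = x₀ ∧
      (∀ k < N, x (k + 1) = x k + h • F k ∧ ‖F k‖ ≤ M ∧ ∃ s ∈ Icc (0 : ℝ) T,
        |t₀ + k * h - s| ≤ η ∧ ∃ y, ‖x k - y‖ ≤ η ∧ ∃ w ∈ U, F k = f s y w) ∧
      ∃ s ∈ Icc (0 : ℝ) T, T - η ≤ s ∧ ∃ y, ‖x N - y‖ ≤ η ∧ vbar s y < 0 := by
  obtain ⟨B, hB⟩ : ∃ B, ∀ s ∈ Icc (0 : ℝ) T, ∀ y : EuclideanSpace ℝ (Fin n), ‖y‖ ≤ R + 1 →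
      |vbar s y| ≤ B := by
    have hK : IsCompact (Icc (0 : ℝ) T ×ˢ Metric.closedBall (0 : EuclideanSpace ℝ (Fin n)) (R + 1)) :=
      isCompact_Icc.prod (isCompact_closedBall _ _)
    obtain ⟨B, hB⟩ := hK.exists_bound_of_continuousOn
      (hvc.mono (prod_mono le_rfl (subset_univ _)))
    exact ⟨B, fun s hs y hy => hB (s, y) ⟨hs, by simpa using hy⟩⟩
  have hB0 : 0 ≤ B := (abs_nonneg _).trans (hB 0 ⟨le_rfl, hT.le⟩ 0 (by simp; linarith))
  obtain ⟨ht0, htT⟩ := ht₀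
  obtain ⟨ε, hε, hε1, hε2, hε3, hε4⟩ : ∃ ε : ℝ, 0 < ε ∧ ε < 1 ∧ ε < t₀ ∧ 2 * ε < T - t₀ ∧ 4 * ε ≤ η := by
    refine ⟨min (min (1 / 2) (t₀ / 2)) (min ((T - t₀) / 4) (η / 4)), ?_, ?_, ?_, ?_, ?_⟩
    · refine lt_min (lt_min ?_ ?_) (lt_min ?_ ?_) <;> linarith
    · linarith [(min_le_left (min (1 / 2) (t₀ / 2)) (min ((T - t₀) / 4) (η / 4))),
        min_le_left (1 / 2) (t₀ / 2)]
    · linarith [(min_le_left (min (1 / 2) (t₀ / 2)) (min ((T - t₀) / 4) (η / 4))),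
        min_le_right (1 / 2) (t₀ / 2)]
    · linarith [(min_le_right (min (1 / 2) (t₀ / 2)) (min ((T - t₀) / 4) (η / 4))),
        min_le_left ((T - t₀) / 4) (η / 4)]
    · linarith [(min_le_right (min (1 / 2) (t₀ / 2)) (min ((T - t₀) / 4) (η / 4))),
        min_le_right ((T - t₀) / 4) (η / 4)]
  obtain ⟨κ, hκ, hκB⟩ : ∃ κ : ℝ, 0 < κ ∧ 2 * B ≤ κ * ε ^ 2 := by
    refine ⟨2 * B / ε ^ 2 + 1, by positivity, ?_⟩
    have : (2 * B / ε ^ 2 + 1) * ε ^ 2 = 2 * B + ε ^ 2 := by field_simp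
    rw [this]; nlinarith
  obtain ⟨W, hWle, hWex⟩ := aux_W T hT vbar hvc κ R hR
  -- choose the number of steps
  set S := T - 2 * ε - t₀ with hS
  have hSpos : 0 < S := by linarith
  set A := S * κ * (1 + M ^ 2) with hA
  have hApos : 0 < A := by positivity
  obtain ⟨N, hN⟩ := exists_nat_gt (max (S / η) (S * A / (-vbar t₀ x₀)))
  have hN1 : S / η < N := (le_max_left _ _).trans_lt hN
  have hN2 : S * A / (-vbar t₀ x₀) < N := (le_max_right _ _).trans_lt hN
  have hNpos : (0 : ℝ) < N := lt_trans (by positivity) hN1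
  set h := S / N with hh
  have hpos : 0 < h := by positivity
  have hNh : N * h = S := by rw [hh]; field_simp
  have hhη : h ≤ η := by
    rw [hh, div_le_iff₀ hNpos]
    rw [div_lt_iff₀ hη] at hN1
    linarith
  have hhA : h * A < -vbar t₀ x₀ := by
    rw [div_lt_iff₀ (by linarith)] at hN2
    rw [hh, div_mul_eq_mul_div, div_lt_iff₀ hNpos]
    linarith
  set Inv : ℕ → EuclideanSpace ℝ (Fin n) → Prop := fun k x =>
    2 + ‖x‖ ≤ (2 + ρ) * Real.exp (C * (k * h)) ∧
      W (t₀ + k * h) x ≤ vbar t₀ x₀ + k * (κ * h ^ 2 * (1 + M ^ 2)) with hInv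
  have hkS : ∀ k : ℕ, k ≤ N → (k : ℝ) * h ≤ S := by
    intro k hk
    rw [← hNh]
    have : (k : ℝ) ≤ N := by exact_mod_cast hk
    gcongr
  have hcons : ∀ k x, k ≤ N → Inv k x → ‖x‖ ≤ R ∧ W (t₀ + k * h) x < 0 := by
    rintro k x hk ⟨h1, h2⟩
    have hk' := hkS k hk
    constructor
    · have : (2 + ρ) * Real.exp (C * (k * h)) ≤ (2 + ρ) * Real.exp (C * T) := by
        gcongr
        linarith
      linarith
    · have : k * (κ * h ^ 2 * (1 + M ^ 2)) ≤ h * A := by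
        calc k * (κ * h ^ 2 * (1 + M ^ 2)) = (k * h) * (κ * h * (1 + M ^ 2)) := by ring
          _ ≤ S * (κ * h * (1 + M ^ 2)) := by gcongr
          _ = h * A := by rw [hA]; ring
      linarith
  have hstep : ∀ (k : ℕ) (x : EuclideanSpace ℝ (Fin n)), ∃ G : EuclideanSpace ℝ (Fin n),
      k < N → Inv k x → Inv (k + 1) (x + h • G) ∧ ‖G‖ ≤ M ∧ ∃ s ∈ Icc (0 : ℝ) T,
        |t₀ + k * h - s| ≤ η ∧ ∃ y, ‖x - y‖ ≤ η ∧ ∃ w ∈ U, G = f s y w := by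
    intro k x
    by_cases hk : k < N ∧ Inv k x
    swap
    · exact ⟨0, fun h1 h2 => absurd ⟨h1, h2⟩ hk⟩
    obtain ⟨hk, hI⟩ := hk
    obtain ⟨hxR, hWneg⟩ := hcons k x hk.le hI
    have hk' := hkS k hk.le
    have hk0 : 0 ≤ (k : ℝ) * h := by positivity
    obtain ⟨s, hs, hs1, y, hy, w, hw, hdec⟩ := aux_step T U f H hH vbar hsuper κ ε B R hκ hε hε1 W hB
      hκB hWle hWex (t₀ + k * h) x (by linarith) (by linarith) hxR hWneg
    have hyx : ‖y‖ ≤ ‖x‖ + 1 := by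
      have : ‖y‖ ≤ ‖x‖ + ‖x - y‖ := by
        have := norm_sub_le x (x - y)
        simpa using this
      linarith
    have hGM : ‖f s y w‖ ≤ M := hfM s hs y (by linarith) w hw
    refine ⟨f s y w, fun _ _ => ⟨⟨?_, ?_⟩, hGM, s, hs, by linarith, y, by linarith, w, hw, rfl⟩⟩
    · have h1 : ‖x + h • f s y w‖ ≤ ‖x‖ + h * (C * (2 + ‖x‖)) := by
        refine (norm_add_le _ _).trans ?_
        rw [norm_smul, Real.norm_eq_abs, abs_of_pos hpos]
        gcongr
        refine (hfC s hs y w hw).trans ?_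
        exact mul_le_mul_of_nonneg_left (by linarith) hC
      have h2 : C * h + 1 ≤ Real.exp (C * h) := Real.add_one_le_exp _
      have h3 : C * (((k + 1 : ℕ) : ℝ) * h) = C * (k * h) + C * h := by push_cast; ring
      rw [h3, Real.exp_add]
      calc 2 + ‖x + h • f s y w‖ ≤ (2 + ‖x‖) * (C * h + 1) := by nlinarith [h1]
        _ ≤ ((2 + ρ) * Real.exp (C * (k * h))) * Real.exp (C * h) := by
            gcongr
            exact hI.1
        _ = _ := by ring
    · have h1 := hdec h hpos.le
      have h3 : t₀ + ((k + 1 : ℕ) : ℝ) * h = t₀ + k * h + h := by push_cast; ring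
      rw [h3]
      have h4 : κ * h ^ 2 * (1 + ‖f s y w‖ ^ 2) ≤ κ * h ^ 2 * (1 + M ^ 2) := by gcongr
      have h5 := hI.2
      push_cast
      linarith
  choose G hG using hstep
  let x : ℕ → EuclideanSpace ℝ (Fin n) := fun k => Nat.rec x₀ (fun k z => z + h • G k z) k
  have hx0 : x 0 = x₀ := rfl
  have hxs : ∀ k, x (k + 1) = x k + h • G k (x k) := fun k => rfl
  have hall : ∀ k, k ≤ N → Inv k (x k) := by
    intro k
    induction k with
    | zero =>
      intro _
      refine ⟨?_, ?_⟩
      · simp [hx0]; exact hx₀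
      · have h1 := hWle t₀ x₀ t₀ ⟨ht0.le, htT.le⟩ x₀ (by
          have : 1 ≤ Real.exp (C * T) := Real.one_le_exp (by positivity)
          nlinarith)
        rw [hx0]
        simpa using h1
    | succ k ih =>
      intro hk
      rw [hxs]
      exact (hG k (x k) hk (ih (by omega))).1
  refine ⟨N, h, x, fun k => G k (x k), hpos, hhη, by linarith, by linarith, hx0, ?_, ?_⟩
  · intro k hk
    obtain ⟨-, h2, h3⟩ := hG k (x k) hk (hall k hk.le)
    exact ⟨hxs k, h2, h3⟩
  · obtain ⟨hxR, hWneg⟩ := hcons N (x N) le_rfl (hall N le_rfl)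
    obtain ⟨s, hs, y, hy, he⟩ := hWex (t₀ + N * h) (x N)
    obtain ⟨hn1, hn2⟩ := aux_near κ ε B R T hκ hε vbar W hB hκB hWle (t₀ + N * h) (x N)
      ⟨by linarith, by linarith⟩ hxR s y hs hy he
    refine ⟨s, hs, ?_, y, by linarith, ?_⟩
    · have := (abs_le.1 hn1).2
      linarith
    · have : 0 ≤ κ * ((t₀ + N * h - s) ^ 2 + ‖x N - y‖ ^ 2) := by positivity
      linarith

lemma aux_curve {n m : ℕ} (T : ℝ)
    (U : Set (Fin m → ℝ))
    (f : ℝ → EuclideanSpace ℝ (Fin n) → (Fin m → ℝ) → EuclideanSpace ℝ (Fin n))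
    (M : ℝ) (hM : 0 ≤ M) (t₀ : ℝ) (η : ℝ) (N : ℕ) (h : ℝ) (x F : ℕ → EuclideanSpace ℝ (Fin n))
    (hh : 0 < h) (hhη : h ≤ η) (hT2 : T - η ≤ t₀ + N * h)
    (hstep : ∀ k < N, x (k + 1) = x k + h • F k ∧ ‖F k‖ ≤ M ∧ ∃ s ∈ Icc (0 : ℝ) T,
        |t₀ + k * h - s| ≤ η ∧ ∃ y, ‖x k - y‖ ≤ η ∧ ∃ w ∈ U, F k = f s y w) (hTN : t₀ + N * h ≤ T) :
    ∃ Y : ℝ → EuclideanSpace ℝ (Fin n), Y t₀ = x 0 ∧ Y T = x N ∧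
      (∀ a b, a ≤ b → ‖Y b - Y a‖ ≤ M * (b - a + η)) ∧
      (∀ a b, t₀ ≤ a → a ≤ b → b ≤ T - η → ∀ p c,
        (∀ r ∈ Icc (0 : ℝ) T, a - 2 * η ≤ r → r ≤ b + 2 * η → ∀ y,
          ‖y - Y a‖ ≤ M * (b - a) + (M + 1) * η → ∀ w ∈ U, ⟪p, f r y w⟫ ≤ c) →
        ⟪p, Y b - Y a⟫ ≤ c * (b - a) + |c| * η) := by
  have hη : 0 < η := hh.trans_le hhη
  have hnorm : ∀ i d, i + d ≤ N → ‖x (i + d) - x i‖ ≤ M * (h * d) := by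
    intro i d
    induction d with
    | zero => intro _; simp
    | succ d ih =>
      intro hd
      obtain ⟨h1, h2, -⟩ := hstep (i + d) (by omega)
      rw [← add_assoc, h1]
      have : x (i + d) + h • F (i + d) - x i = (x (i + d) - x i) + h • F (i + d) := by abel
      rw [this]
      refine (norm_add_le _ _).trans ?_
      rw [norm_smul, Real.norm_eq_abs, abs_of_pos hh]
      have := ih (by omega)
      push_cast
      nlinarith
  have hinner : ∀ (p : EuclideanSpace ℝ (Fin n)) (c : ℝ) i d, i + d ≤ N →
      (∀ k, i ≤ k → k < i + d → ⟪p, F k⟫ ≤ c) → ⟪p, x (i + d) - x i⟫ ≤ c * (h * d) := by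
    intro p c i d
    induction d with
    | zero => intro _ _; simp
    | succ d ih =>
      intro hd hk
      obtain ⟨h1, -⟩ := hstep (i + d) (by omega)
      rw [← add_assoc, h1]
      have : x (i + d) + h • F (i + d) - x i = (x (i + d) - x i) + h • F (i + d) := by abel
      rw [this, inner_add_right, inner_smul_right]
      have e1 := ih (by omega) fun k hk1 hk2 => hk k hk1 (by omega)
      have e2 := hk (i + d) (by omega) (by omega)
      push_cast
      nlinarith
  set ι : ℝ → ℕ := fun r => min ⌊(r - t₀) / h⌋₊ N with hι
  have hιN : ∀ r, ι r ≤ N := fun r => min_le_right _ _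
  have hmono : ∀ a b, a ≤ b → ι a ≤ ι b := by
    intro a b hab
    refine min_le_min ?_ le_rfl
    gcongr
  have hlow : ∀ r, t₀ ≤ r → ι r * h ≤ r - t₀ := by
    intro r hr
    have h1 : (ι r : ℝ) ≤ (⌊(r - t₀) / h⌋₊ : ℝ) := by exact_mod_cast min_le_left _ _
    have h2 : (⌊(r - t₀) / h⌋₊ : ℝ) ≤ (r - t₀) / h := Nat.floor_le (div_nonneg (by linarith) hh.le)
    rw [← le_div_iff₀ hh]; linarith
  have hup : ∀ r, r ≤ t₀ + N * h → r - t₀ ≤ ι r * h + h := by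
    intro r hr
    rcases le_total ⌊(r - t₀) / h⌋₊ N with h1 | h1
    · have : ι r = ⌊(r - t₀) / h⌋₊ := min_eq_left h1
      rw [this]
      have := (Nat.lt_floor_add_one ((r - t₀) / h)).le
      rw [div_le_iff₀ hh] at this
      linarith
    · have : ι r = N := min_eq_right h1
      rw [this]; linarith
  have hdiff : ∀ a b, a ≤ b → (ι b * h - ι a * h : ℝ) ≤ b - a + h := by
    intro a b hab
    rcases le_total b t₀ with hb | hb
    · have : ι b = 0 := by
        simp only [hι]
        rw [Nat.floor_of_nonpos (div_nonpos_of_nonpos_of_nonneg (by linarith) hh.le)]; simp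
      rw [this]
      have : (0 : ℝ) ≤ ι a * h := by positivity
      simp; linarith
    · have e1 := hlow b hb
      rcases le_total a (t₀ + N * h) with ha | ha
      · have := hup a ha
        linarith
      · have e3 : ι a = N := by
          simp only [hι]
          refine min_eq_right (Nat.le_floor ?_)
          rw [le_div_iff₀ hh]; linarith
        have e4 : (ι b : ℝ) ≤ N := by exact_mod_cast hιN b
        rw [e3]
        nlinarith
  refine ⟨fun r => x (ι r), ?_, ?_, ?_, ?_⟩
  · simp [hι]
  · have : ι T = N := by
      simp only [hι]
      refine min_eq_right (Nat.le_floor ?_)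
      rw [le_div_iff₀ hh]; linarith
    simp only [this]
  · intro a b hab
    obtain ⟨d, hd⟩ := Nat.exists_eq_add_of_le (hmono a b hab)
    have e1 := hnorm (ι a) d (by rw [← hd]; exact hιN b)
    have e2 := hdiff a b hab
    simp only [hd]
    rw [hd] at e2
    push_cast at e2
    refine e1.trans ?_
    gcongr
    linarith
  · intro a b ha hab hb p c hc
    obtain ⟨d, hd⟩ := Nat.exists_eq_add_of_le (hmono a b hab)
    have e2 := hdiff a b hab
    have e3 := hlow b (by linarith)
    have e4 := hup b (by linarith)
    have e5 := hlow a ha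
    have e6 := hup a (by linarith)
    simp only [hd]
    simp only [hd] at e2 e3 e4
    push_cast at e2 e3 e4
    have e1 := hinner p c (ι a) d (by rw [← hd]; exact hιN b) (by
      intro k hk1 hk2
      have hkN : k < N := by
        have := hιN b
        omega
      obtain ⟨-, -, s, hs, hs1, y, hy, w, hw, hFe⟩ := hstep k hkN
      rw [hFe]
      obtain ⟨k', rfl⟩ := Nat.exists_eq_add_of_le hk1
      have hk'd : (k' : ℝ) ≤ d := by
        have : k' ≤ d := by omega
        exact_mod_cast this
      have hk'h : (k' : ℝ) * h ≤ d * h := by gcongr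
      have hk'0 : (0 : ℝ) ≤ k' * h := by positivity
      obtain ⟨g1, g2⟩ := abs_le.1 hs1
      push_cast at g1 g2
      refine hc s hs (by linarith) (by linarith) y ?_ w hw
      have g3 := hnorm (ι a) k' hkN.le
      have g4 : ‖y - x (ι a)‖ ≤ ‖x (ι a + k') - x (ι a)‖ + ‖x (ι a + k') - y‖ := by
        have : y - x (ι a) = (x (ι a + k') - x (ι a)) - (x (ι a + k') - y) := by abel
        rw [this]; exact norm_sub_le _ _
      have g5 : M * (h * k') ≤ M * (b - a + η) := by
        gcongr
        linarith
      linarith)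
    refine e1.trans ?_
    have e7 : c * (h * d - (b - a)) ≤ |c| * η := by
      refine (le_abs_self _).trans ?_
      rw [abs_mul]
      gcongr
      rw [abs_le]
      constructor <;> linarith
    linarith

lemma aux_limit {n m : ℕ} (T : ℝ)
    (U : Set (Fin m → ℝ))
    (f : ℝ → EuclideanSpace ℝ (Fin n) → (Fin m → ℝ) → EuclideanSpace ℝ (Fin n))
    (vbar : ℝ → EuclideanSpace ℝ (Fin n) → ℝ)
    (hvc : ContinuousOn (fun z : ℝ × EuclideanSpace ℝ (Fin n) => vbar z.1 z.2)
      (Set.Icc 0 T ×ˢ (Set.univ : Set (EuclideanSpace ℝ (Fin n)))))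
    (M : ℝ) (hM : 0 ≤ M) (t : ℝ) (x : EuclideanSpace ℝ (Fin n)) (hT : 0 < T)
    (hY : ∀ η : ℝ, 0 < η → η ≤ 1 → ∃ Y : ℝ → EuclideanSpace ℝ (Fin n),
      ‖Y t - x‖ ≤ η + 2 * M * η ∧
      (∀ a b, a ≤ b → ‖Y b - Y a‖ ≤ M * (b - a + η)) ∧
      (∀ a b, t + η ≤ a → a ≤ b → b ≤ T - η → ∀ p c,
        (∀ r ∈ Icc (0 : ℝ) T, a - 2 * η ≤ r → r ≤ b + 2 * η → ∀ y,
          ‖y - Y a‖ ≤ M * (b - a) + (M + 1) * η → ∀ w ∈ U, ⟪p, f r y w⟫ ≤ c) →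
        ⟪p, Y b - Y a⟫ ≤ c * (b - a) + |c| * η) ∧
      ∃ s ∈ Icc (0 : ℝ) T, T - η ≤ s ∧ ∃ y, ‖Y T - y‖ ≤ η ∧ vbar s y < 0) :
    ∃ X : ℝ → EuclideanSpace ℝ (Fin n), X t = x ∧ (∀ a b, a ≤ b → ‖X b - X a‖ ≤ M * (b - a)) ∧
      SuppProp U f T t M X ∧ vbar T (X T) ≤ 0 := by
  set e : ℕ → ℝ := fun k => 1 / ((k : ℝ) + 1) with he
  have he0 : ∀ k, 0 < e k := fun k => by simp only [he]; positivity
  have he1 : ∀ k, e k ≤ 1 := fun k => by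
    simp only [he]
    rw [div_le_one (by positivity)]
    have : (0 : ℝ) ≤ k := by positivity
    linarith
  choose Y h1 h2 h3 s hs hsT y hy hv using fun k => hY (e k) (he0 k) (he1 k)
  set 𝒰 : Filter ℕ := (Filter.hyperfilter ℕ : Filter ℕ) with h𝒰
  have helim : Filter.Tendsto e 𝒰 (nhds 0) :=
    (tendsto_one_div_add_atTop_nhds_zero_nat (𝕜 := ℝ)).mono_left Nat.hyperfilter_le_atTop
  have hex : ∀ r, ∃ z, Filter.Tendsto (fun k => Y k r) 𝒰 (nhds z) := by
    intro r
    have hb : ∀ k, Y k r ∈ Metric.closedBall x (M * (|r - t| + 1) + (1 + 2 * M)) := by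
      intro k
      rw [mem_closedBall_iff_norm]
      have e1 : ‖Y k r - Y k t‖ ≤ M * (|r - t| + 1) := by
        rcases le_total t r with h | h
        · refine (h2 k t r h).trans ?_
          gcongr
          · exact le_abs_self _
          · exact he1 k
        · rw [norm_sub_rev]
          refine (h2 k r t h).trans ?_
          gcongr
          · rw [abs_sub_comm]; exact le_abs_self _
          · exact he1 k
      have e2 : ‖Y k t - x‖ ≤ 1 + 2 * M := by
        refine (h1 k).trans ?_
        have := he1 k
        have := he0 k
        nlinarith
      have : Y k r - x = (Y k r - Y k t) + (Y k t - x) := by abel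
      rw [this]
      exact (norm_add_le _ _).trans (add_le_add e1 e2)
    obtain ⟨z, -, hz⟩ := (isCompact_closedBall x (M * (|r - t| + 1) + (1 + 2 * M))).ultrafilter_le_nhds
      ((Filter.hyperfilter ℕ).map fun k => Y k r) (by
        rw [Filter.le_principal_iff]
        rw [Ultrafilter.coe_map, Filter.mem_map]
        exact Filter.univ_mem' hb)
    exact ⟨z, hz⟩
  choose X hX using hex
  refine ⟨X, ?_, ?_, ?_, ?_⟩
  · have l1 : Filter.Tendsto (fun k => ‖Y k t - x‖) 𝒰 (nhds ‖X t - x‖) :=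
      ((hX t).sub_const x).norm
    have l2 : Filter.Tendsto (fun k => e k + 2 * M * e k) 𝒰 (nhds (0 + 2 * M * 0)) :=
      helim.add (helim.const_mul _)
    have := le_of_tendsto_of_tendsto' l1 l2 h1
    simp only [mul_zero, add_zero] at this
    exact sub_eq_zero.1 (norm_le_zero_iff.1 this)
  · intro a b hab
    have l1 : Filter.Tendsto (fun k => ‖Y k b - Y k a‖) 𝒰 (nhds ‖X b - X a‖) :=
      ((hX b).sub (hX a)).norm
    have l2 : Filter.Tendsto (fun k => M * (b - a + e k)) 𝒰 (nhds (M * (b - a + 0))) :=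
      (helim.const_add _).const_mul _
    have := le_of_tendsto_of_tendsto' l1 l2 fun k => h2 k a b hab
    simpa using this
  · intro η hη a b hta hab hbT p c hc
    have l1 : Filter.Tendsto (fun k => ⟪p, Y k b - Y k a⟫) 𝒰 (nhds ⟪p, X b - X a⟫) :=
      Filter.Tendsto.inner tendsto_const_nhds ((hX b).sub (hX a))
    have l2 : Filter.Tendsto (fun k => c * (b - a) + |c| * e k) 𝒰 (nhds (c * (b - a) + |c| * 0)) :=
      (helim.const_mul _).const_add _
    have l3 : Filter.Tendsto (fun k => ‖Y k a - X a‖ + (M + 1) * e k) 𝒰 (nhds (0 + (M + 1) * 0)) := by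
      refine Filter.Tendsto.add ?_ (helim.const_mul _)
      have := ((hX a).sub_const (X a)).norm
      simpa using this
    have h4 : ∀ᶠ k in 𝒰, ⟪p, Y k b - Y k a⟫ ≤ c * (b - a) + |c| * e k := by
      filter_upwards [helim.eventually_lt_const (u := η / 2) (by positivity),
        helim.eventually_lt_const (u := a - t) (by linarith),
        helim.eventually_lt_const (u := T - b) (by linarith),
        l3.eventually_lt_const (u := η) (by simpa using hη)] with k k1 k2 k3 k4
      refine h3 k a b (by linarith) hab.le (by linarith) p c ?_
      intro r hr hr1 hr2 y hy w hw
      refine hc r hr (by linarith) (by linarith) y ?_ w hw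
      have : y - X a = (y - Y k a) + (Y k a - X a) := by abel
      rw [this]
      refine (norm_add_le _ _).trans ?_
      linarith
    have := le_of_tendsto_of_tendsto l1 l2 h4
    simpa using this
  · have l1 : Filter.Tendsto s 𝒰 (nhds T) := by
      have l2 : Filter.Tendsto (fun k => T - e k) 𝒰 (nhds (T - 0)) := helim.const_sub _
      rw [sub_zero] at l2
      exact tendsto_of_tendsto_of_tendsto_of_le_of_le l2 tendsto_const_nhds hsT fun k => (hs k).2
    have l3 : Filter.Tendsto y 𝒰 (nhds (X T)) := by
      have l4 : Filter.Tendsto (fun k => Y k T - y k) 𝒰 (nhds 0) :=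
        squeeze_zero_norm hy helim
      have := (hX T).sub l4
      simpa using this
    have hcw := hvc (T, X T) ⟨⟨hT.le, le_rfl⟩, mem_univ _⟩
    have l5 : Filter.Tendsto (fun k => (s k, y k)) 𝒰
        (nhdsWithin (T, X T) (Set.Icc 0 T ×ˢ (Set.univ : Set (EuclideanSpace ℝ (Fin n))))) := by
      refine tendsto_nhdsWithin_iff.2 ⟨l1.prodMk_nhds l3, ?_⟩
      exact Filter.Eventually.of_forall fun k => ⟨hs k, mem_univ _⟩
    have l6 := hcw.tendsto.comp l5
    exact le_of_tendsto l6 (Filter.Eventually.of_forall fun k => (hv k).le)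

/-- If `v̄` is a continuous viscosity supersolution of `−v_t + H(t,x,∇v) = 0` on its strict
zero-sublevel set, `x ↦ v̄(t,x)` is of class `Z` for every `t`, and the terminal data `ḡ`
is positive outside the target `𝒳 = {g ≤ 0}`, then the zero-sublevel sets of `v̄`
under-approximate the backwards reachable set. -/
theorem under_approx_BRS {n m : ℕ} (T : ℝ) (hT : 0 < T)
    (U : Set (Fin m → ℝ)) (hUc : IsCompact U) (hUne : U.Nonempty)
    (f : ℝ → EuclideanSpace ℝ (Fin n) → (Fin m → ℝ) → EuclideanSpace ℝ (Fin n))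
    (hfc : ContinuousOn
      (fun z : ℝ × EuclideanSpace ℝ (Fin n) × (Fin m → ℝ) => f z.1 z.2.1 z.2.2)
      (Set.Icc 0 T ×ˢ (Set.univ : Set (EuclideanSpace ℝ (Fin n))) ×ˢ U))
    (L : ℝ) (hL : 0 ≤ L)
    (hfl : ∀ s ∈ Set.Icc (0 : ℝ) T, ∀ w ∈ U, ∀ x y : EuclideanSpace ℝ (Fin n),
      ‖f s x w - f s y w‖ ≤ L * ‖x - y‖)
    (hconv : ∀ s ∈ Set.Icc (0 : ℝ) T, ∀ x, Convex ℝ ((f s x) '' U))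
    (H : ℝ → EuclideanSpace ℝ (Fin n) → EuclideanSpace ℝ (Fin n) → ℝ)
    (hH : ∀ t ∈ Set.Icc (0 : ℝ) T, ∀ x p,
      IsGreatest ((fun w => ⟪-p, f t x w⟫) '' U) (H t x p))
    (g : EuclideanSpace ℝ (Fin n) → ℝ) (hg : Continuous g)
    (vbar : ℝ → EuclideanSpace ℝ (Fin n) → ℝ)
    (hvc : ContinuousOn (fun z : ℝ × EuclideanSpace ℝ (Fin n) => vbar z.1 z.2)
      (Set.Icc 0 T ×ˢ (Set.univ : Set (EuclideanSpace ℝ (Fin n)))))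
    (hsuper : ∀ t₀ ∈ Set.Ioo (0 : ℝ) T, ∀ x₀, vbar t₀ x₀ < 0 →
      ∀ pt px, IsSubGrad vbar t₀ x₀ pt px → 0 ≤ -pt + H t₀ x₀ px)
    (gbar : EuclideanSpace ℝ (Fin n) → ℝ)
    (hterm : ∀ x, vbar T x = gbar x)
    (hZ : ∀ t ∈ Set.Icc (0 : ℝ) T, ClassZ (vbar t))
    (hgbar : ∀ x, ¬ g x ≤ 0 → 0 < gbar x) :
    ∀ t ∈ Set.Icc (0 : ℝ) T, {x | vbar t x ≤ 0} ⊆ Reach U f g T t := by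
  intro t ht x hx
  simp only [mem_ofPred_eq] at hx
  have hfin : ∀ z, vbar T z ≤ 0 → g z ≤ 0 := by
    intro z hz
    by_contra hc
    have := hgbar z hc
    rw [hterm] at hz
    linarith
  rcases eq_or_lt_of_le ht.2 with rfl | htT
  · obtain ⟨w, hw⟩ := hUne
    refine ⟨fun _ => w, fun _ => x, ⟨measurable_const, fun _ _ => hw⟩, ⟨continuousOn_const, ?_⟩, hfin x hx⟩
    intro s hs
    have : s = t := le_antisymm hs.2 hs.1
    simp [this]
  obtain ⟨C, hC, hfC⟩ : ∃ C : ℝ, 0 ≤ C ∧ ∀ s ∈ Icc (0 : ℝ) T, ∀ y, ∀ w ∈ U,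
      ‖f s y w‖ ≤ C * (1 + ‖y‖) := by
    have hK : IsCompact (Icc (0 : ℝ) T ×ˢ ({0} : Set (EuclideanSpace ℝ (Fin n))) ×ˢ U) :=
      isCompact_Icc.prod (isCompact_singleton.prod hUc)
    obtain ⟨C₀, hC₀⟩ := hK.exists_bound_of_continuousOn
      (hfc.mono (prod_mono le_rfl (prod_mono (subset_univ _) le_rfl)))
    have hC₁ : ∀ s ∈ Icc (0 : ℝ) T, ∀ w ∈ U, ‖f s 0 w‖ ≤ C₀ :=
      fun s hs w hw => hC₀ (s, 0, w) ⟨hs, rfl, hw⟩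
    obtain ⟨w₀, hw₀⟩ := hUne
    have hC00 : 0 ≤ C₀ := (norm_nonneg _).trans (hC₁ 0 ⟨le_rfl, hT.le⟩ w₀ hw₀)
    refine ⟨C₀ + L, by positivity, fun s hs y w hw => ?_⟩
    have a1 := hC₁ s hs w hw
    have a2 := hfl s hs w hw y 0
    rw [sub_zero] at a2
    have a3 : ‖f s y w‖ ≤ ‖f s 0 w‖ + ‖f s y w - f s 0 w‖ := by
      have := norm_add_le (f s 0 w) (f s y w - f s 0 w)
      simpa using this
    nlinarith [norm_nonneg y]
  set ρ := ‖x‖ + 1 with hρ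
  set R := (2 + ρ) * Real.exp (C * T) with hR
  have hρ0 : 0 ≤ ρ := by positivity
  have hR0 : 0 ≤ R := by positivity
  set M := C * (1 + (R + 1)) with hMdef
  have hM : 0 ≤ M := by positivity
  have hfM : ∀ s ∈ Icc (0 : ℝ) T, ∀ y, ‖y‖ ≤ R + 1 → ∀ w ∈ U, ‖f s y w‖ ≤ M := by
    intro s hs y hy w hw
    refine (hfC s hs y w hw).trans ?_
    rw [hMdef]; gcongr
  obtain ⟨X, hX1, hX2, hX3, hX4⟩ := aux_limit T U f vbar hvc M hM t x hT (by
    intro η hη hη1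
    obtain ⟨x', hx', hv'⟩ : ∃ x', ‖x' - x‖ ≤ η ∧ vbar t x' < 0 := by
      rcases eq_or_lt_of_le hx with h0 | h0
      · obtain ⟨y, hy, hy2⟩ := hZ t ht x h0 η hη
        exact ⟨y, (mem_ball_iff_norm.1 hy).le, hy2⟩
      · exact ⟨x, by simpa using hη.le, h0⟩
    obtain ⟨t', ht'1, ht'2, ht'3, hv2⟩ : ∃ t', t < t' ∧ t' < T ∧ t' < t + η ∧ vbar t' x' < 0 := by
      have hc : ContinuousOn (fun s => vbar s x') (Icc 0 T) :=
        hvc.comp (f := fun s : ℝ => (s, x')) (by fun_prop) fun s hs => ⟨hs, mem_univ _⟩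
      have hc2 := (hc t ht).mono (s := Ioo t T) fun s hs => ⟨ht.1.trans hs.1.le, hs.2.le⟩
      have e1 := hc2.tendsto.eventually_lt_const hv'
      rw [nhdsWithin_Ioo_eq_nhdsGT htT] at e1
      have e2 : ∀ᶠ s in nhdsWithin t (Ioi t), s ∈ Ioo t (min T (t + η)) :=
        Ioo_mem_nhdsGT (lt_min htT (by linarith))
      obtain ⟨s, hs1, hs2⟩ := (e1.and e2).exists
      exact ⟨s, hs2.1, hs2.2.trans_le (min_le_left _ _), hs2.2.trans_le (min_le_right _ _), hs1⟩
    have hx'ρ : ‖x'‖ ≤ ρ := by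
      have := norm_add_le x (x' - x)
      rw [add_sub_cancel] at this
      rw [hρ]; linarith
    obtain ⟨N, h, ξ, F, hh, hhη, hN1, hN2, hξ0, hstep, s, hs, hsT, y, hy, hvy⟩ :=
      aux_seq T hT U f H hH vbar hvc hsuper C M R ρ hC hR0 hρ0 hR.symm.le hfC hfM t'
        ⟨ht.1.trans_lt ht'1, ht'2⟩ x' hx'ρ hv2 η hη
    obtain ⟨Y, hY0, hYT, hYL, hYS⟩ := aux_curve T U f M hM t' η N h ξ F hh hhη hN2 hstep hN1
    refine ⟨Y, ?_, hYL, ?_, s, hs, hsT, y, by rw [hYT]; exact hy, hvy⟩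
    · have b1 := hYL t t' ht'1.le
      have b2 : Y t - x = (x' - x) - (Y t' - Y t) := by rw [hY0, hξ0]; abel
      rw [b2]
      refine (norm_sub_le _ _).trans ?_
      have b3 : M * (t' - t + η) ≤ M * (2 * η) := by
        gcongr
        linarith
      linarith
    · intro a b ha hab hb
      exact hYS a b (by linarith) hab hb)
  obtain ⟨u, hu1, hu2⟩ := aux_traj T hT U hUc hUne f hfc hconv t M ht.1 hM X hX2 hX3
  rw [hX1] at hu2
  exact ⟨u, X, hu1, hu2, hfin _ hX4⟩

end
end

section
/- Fix T > 0, let U ⊂ ℝᵐ be compact and nonempty, let f : [0,T] × ℝⁿ × U → ℝⁿ be continuous and Lipschitz continuous in x uniformly in (s,u). Let g : ℝⁿ → ℝ be continuous, set 𝒳 = {x | g(x) ≤ 0}, and let 𝒢(t) = {x ∈ ℝⁿ | ∃ measurable u : [t,T] → U with φ(T;t,x,u) ∈ 𝒳}. Let v̲ : [0,T] × ℝⁿ → ℝ be continuous, a viscosity subsolution of −v_t + H(t,x,∇v) = 0 (with H(t,x,p) = max_{u∈U} ⟨−p, f(t,x,u)⟩) on the open set Ω = {(t,x) ∈ (0,T)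 × ℝⁿ | v̲(t,x) > 0}, with terminal condition v̲(T,x) = g̲(x) for all x. If g̲(x) ≤ 0 for every x ∈ 𝒳, then for every t ∈ [0,T], 𝒢(t) is contained in the set {x ∈ ℝⁿ | v̲(t,x) ≤ 0}. -/
open scoped RealInnerProductSpace
open Set

noncomputable section

theorem aux_step_sum (W : ℝ → ℝ) (a b e A h0 : ℝ) (hab : a ≤ b) (hh0 : 0 < h0)
    (hW : ∀ s h, a ≤ s → 0 ≤ h → h < h0 → s + h ≤ b → W s - e * h - A * h ^ 2 ≤ W (s + h)) :
    W a - e * (b - a) ≤ W b := by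
  have key : ∀ N : ℕ, 0 < N → (b - a) / N < h0 →
      W a - e * (b - a) - A * (b - a) ^ 2 / N ≤ W b := by
    intro N hN hh
    have hN' : (0 : ℝ) < N := by exact_mod_cast hN
    set h := (b - a) / N with hdef
    have hh' : 0 ≤ h := div_nonneg (by linarith) hN'.le
    have hNh : N * h = b - a := by rw [hdef]; field_simp
    have ind : ∀ k : ℕ, k ≤ N → W a - k * (e * h + A * h ^ 2) ≤ W (a + k * h) := by
      intro k
      induction k with
      | zero => intro _; simp
      | succ k ih =>
        intro hk
        have h1 := ih (by omega)
        have hk' : ((k : ℝ) + 1) ≤ N := by exact_mod_cast hk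
        have h2 := hW (a + k * h) h (by nlinarith [(Nat.cast_nonneg k : (0:ℝ) ≤ k)]) hh' hh
          (by nlinarith)
        have e1 : a + ((k + 1 : ℕ) : ℝ) * h = a + k * h + h := by push_cast; ring
        rw [e1]
        push_cast
        linarith
    have h3 := ind N le_rfl
    have e2 : a + N * h = b := by rw [hNh]; ring
    have e3 : A * (b - a) ^ 2 / N = N * (A * h ^ 2) := by
      rw [← hNh]; field_simp
    rw [e2] at h3
    rw [e3]
    have : (N : ℝ) * (e * h + A * h ^ 2) = e * (b - a) + N * (A * h ^ 2) := by rw [← hNh]; ring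
    linarith
  have lim1 : Filter.Tendsto (fun N : ℕ => (b - a) / (N : ℝ)) Filter.atTop (nhds 0) :=
    tendsto_const_div_atTop_nhds_zero_nat _
  have lim2 : Filter.Tendsto (fun N : ℕ => W a - e * (b - a) - A * (b - a) ^ 2 / (N : ℝ))
      Filter.atTop (nhds (W a - e * (b - a) - 0)) :=
    tendsto_const_nhds.sub (tendsto_const_div_atTop_nhds_zero_nat _)
  rw [sub_zero] at lim2
  refine le_of_tendsto lim2 ?_
  filter_upwards [lim1.eventually (gt_mem_nhds hh0), Filter.eventually_gt_atTop 0] with N h1 h2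
  exact key N h2 h1

theorem aux_supgrad {n : ℕ} (v : ℝ → EuclideanSpace ℝ (Fin n) → ℝ) (A B s s' : ℝ)
    (hA : 0 < A) (hB : 0 < B)
    (x y : EuclideanSpace ℝ (Fin n))
    (hmax : ∀ᶠ z : ℝ × EuclideanSpace ℝ (Fin n) in nhds (s', y),
      v z.1 z.2 - A * (z.1 - s) ^ 2 - B * ‖z.2 - x‖ ^ 2
        ≤ v s' y - A * (s' - s) ^ 2 - B * ‖y - x‖ ^ 2) :
    IsSupGrad v s' y (2 * A * (s' - s)) ((2 * B) • (y - x)) := by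
  intro ε hε
  apply Filter.Eventually.filter_mono nhdsWithin_le_nhds
  have hb : ∀ᶠ z : ℝ × EuclideanSpace ℝ (Fin n) in nhds (s', y), dist z (s', y) < ε / (A + B) :=
    Metric.ball_mem_nhds _ (by positivity)
  filter_upwards [hmax, hb] with z h1 h2
  have e0 : dist z (s', y) = ‖(z.1 - s', z.2 - y)‖ := by
    rw [dist_eq_norm]; rfl
  rw [e0] at h2
  set N := ‖(z.1 - s', z.2 - y)‖ with hN
  have n1 : |z.1 - s'| ≤ N := norm_fst_le (z.1 - s', z.2 - y)
  have n2 : ‖z.2 - y‖ ≤ N := norm_snd_le (z.1 - s', z.2 - y)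
  have hN0 : 0 ≤ N := norm_nonneg _
  have q1 : (z.1 - s') ^ 2 ≤ N ^ 2 := by
    rw [← sq_abs]; gcongr
  have q2 : ‖z.2 - y‖ ^ 2 ≤ N ^ 2 := by gcongr
  have e1 : ‖z.2 - x‖ ^ 2 = ‖z.2 - y‖ ^ 2 + 2 * ⟪y - x, z.2 - y⟫ + ‖y - x‖ ^ 2 := by
    have : z.2 - x = (z.2 - y) + (y - x) := by abel
    rw [this, norm_add_sq_real, real_inner_comm]
  rw [e1] at h1
  rw [real_inner_smul_left]
  have h3 : (A + B) * N ≤ ε := by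
    rw [lt_div_iff₀ (by positivity)] at h2; linarith
  have h4 : (A + B) * N * N ≤ ε * N := by gcongr
  nlinarith

theorem aux_inner_int {n : ℕ} (F : ℝ → EuclideanSpace ℝ (Fin n)) (p : EuclideanSpace ℝ (Fin n))
    (q s h : ℝ) (hh : 0 ≤ h) (hF : IntervalIntegrable F MeasureTheory.volume s (s + h))
    (hq : ∀ r ∈ Set.Icc s (s + h), q ≤ ⟪p, F r⟫) :
    h * q ≤ ⟪p, ∫ r in s..(s + h), F r⟫ := by
  have e := ContinuousLinearMap.intervalIntegral_comp_comm (innerSL ℝ p) hF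
  simp only [innerSL_apply_apply] at e
  rw [← e]
  have hi : IntervalIntegrable (fun r => ⟪p, F r⟫) MeasureTheory.volume s (s + h) := by
    exact ⟨(innerSL ℝ p).integrable_comp hF.1, (innerSL ℝ p).integrable_comp hF.2⟩
  have := intervalIntegral.integral_mono_on (f := fun _ => q) (by linarith) (by simp) hi hq
  simpa using this

theorem aux_integrable {n m : ℕ} (T : ℝ)
    (U : Set (Fin m → ℝ)) (hUc : IsCompact U)
    (f : ℝ → EuclideanSpace ℝ (Fin n) → (Fin m → ℝ) → EuclideanSpace ℝ (Fin n))
    (hfc : ContinuousOn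
      (fun z : ℝ × EuclideanSpace ℝ (Fin n) × (Fin m → ℝ) => f z.1 z.2.1 z.2.2)
      (Set.Icc 0 T ×ˢ (Set.univ : Set (EuclideanSpace ℝ (Fin n))) ×ˢ U))
    (t : ℝ) (ht : t ∈ Set.Icc 0 T) (u : ℝ → (Fin m → ℝ)) (hu : Admissible U t T u)
    (X : ℝ → EuclideanSpace ℝ (Fin n)) (hX : ContinuousOn X (Set.Icc t T)) (C : ℝ)
    (hC : ∀ r ∈ Set.Icc t T, ‖f r (X r) (u r)‖ ≤ C) :
    MeasureTheory.IntegrableOn (fun r => f r (X r) (u r)) (Set.Icc t T) := by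
  classical
  refine MeasureTheory.IntegrableOn.of_bound (by simp) ?_ C ?_
  · set S : Set (ℝ × EuclideanSpace ℝ (Fin n) × (Fin m → ℝ)) :=
      (Set.Icc 0 T ×ˢ (Set.univ : Set (EuclideanSpace ℝ (Fin n))) ×ˢ U) with hS
    have hSm : MeasurableSet S :=
      measurableSet_Icc.prod (MeasurableSet.univ.prod hUc.measurableSet)
    have hG := ContinuousOn.measurable_piecewise hfc
      (continuousOn_const (c := (0 : EuclideanSpace ℝ (Fin n)))) hSm
    have hXm : AEMeasurable X (MeasureTheory.volume.restrict (Set.Icc t T)) :=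
      hX.aemeasurable measurableSet_Icc
    have hc := hG.comp_aemeasurable (aemeasurable_id.prodMk (hXm.prodMk hu.1.aemeasurable))
    refine AEMeasurable.aestronglyMeasurable (hc.congr ?_)
    filter_upwards [MeasureTheory.ae_restrict_mem measurableSet_Icc] with r hr
    have : (r, X r, u r) ∈ S := ⟨⟨ht.1.trans hr.1, hr.2⟩, trivial, hu.2 r hr⟩
    simp [Set.piecewise, this]
  · filter_upwards [MeasureTheory.ae_restrict_mem measurableSet_Icc] with r hr
    exact hC r hr

set_option maxHeartbeats 1000000 in
theorem aux_core {n m : ℕ} (T : ℝ)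
    (U : Set (Fin m → ℝ)) (hUc : IsCompact U)
    (f : ℝ → EuclideanSpace ℝ (Fin n) → (Fin m → ℝ) → EuclideanSpace ℝ (Fin n))
    (hfc : ContinuousOn
      (fun z : ℝ × EuclideanSpace ℝ (Fin n) × (Fin m → ℝ) => f z.1 z.2.1 z.2.2)
      (Set.Icc 0 T ×ˢ (Set.univ : Set (EuclideanSpace ℝ (Fin n))) ×ˢ U))
    (L : ℝ) (hL : 0 ≤ L)
    (hfl : ∀ s ∈ Set.Icc (0 : ℝ) T, ∀ w ∈ U, ∀ x y : EuclideanSpace ℝ (Fin n),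
      ‖f s x w - f s y w‖ ≤ L * ‖x - y‖)
    (vlow : ℝ → EuclideanSpace ℝ (Fin n) → ℝ)
    (hvc : ContinuousOn (fun z : ℝ × EuclideanSpace ℝ (Fin n) => vlow z.1 z.2)
      (Set.Icc 0 T ×ˢ (Set.univ : Set (EuclideanSpace ℝ (Fin n)))))
    (hsub : ∀ t₀ ∈ Set.Ioo (0 : ℝ) T, ∀ x₀, 0 < vlow t₀ x₀ →
      ∀ pt px, IsSupGrad vlow t₀ x₀ pt px → ∀ w ∈ U, 0 ≤ pt + ⟪px, f t₀ x₀ w⟫)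
    (t : ℝ) (ht : t ∈ Set.Icc 0 T) (x : EuclideanSpace ℝ (Fin n))
    (u : ℝ → (Fin m → ℝ)) (hu : Admissible U t T u)
    (X : ℝ → EuclideanSpace ℝ (Fin n)) (hX : IsTraj f t T x u X)
    (a b : ℝ) (ha0 : 0 < a) (hta : t ≤ a) (hab : a ≤ b) (hbT : b < T)
    (hpos : ∀ s ∈ Set.Icc a b, 0 < vlow s (X s)) :
    vlow a (X a) ≤ vlow b (X b) := by
  obtain ⟨hXc, hXi⟩ := hX
  obtain ⟨R, hR⟩ := isCompact_Icc.exists_bound_of_continuousOn hXc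
  set K : Set (ℝ × EuclideanSpace ℝ (Fin n)) :=
    Set.Icc 0 T ×ˢ Metric.closedBall 0 (R + 1) with hK
  have hKc : IsCompact K := isCompact_Icc.prod (isCompact_closedBall _ _)
  have hvK : ContinuousOn (fun z : ℝ × EuclideanSpace ℝ (Fin n) => vlow z.1 z.2) K :=
    hvc.mono (Set.prod_mono le_rfl (Set.subset_univ _))
  have hXK : ∀ s ∈ Set.Icc t T, (s, X s) ∈ K := fun s hs =>
    ⟨⟨ht.1.trans hs.1, hs.2⟩, by
      rw [mem_closedBall_zero_iff]; linarith [hR s hs]⟩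
  obtain ⟨M0, hM0⟩ := hKc.exists_bound_of_continuousOn hvK
  obtain ⟨M, hM, hMpos⟩ : ∃ M, (∀ z ∈ K, |vlow z.1 z.2| ≤ M) ∧ 0 < M :=
    ⟨max M0 1, fun z hz => (hM0 z hz).trans (le_max_left _ _), by positivity⟩
  set KU : Set (ℝ × EuclideanSpace ℝ (Fin n) × (Fin m → ℝ)) :=
    Set.Icc 0 T ×ˢ Metric.closedBall 0 (R + 1) ×ˢ U with hKU
  have hKUc : IsCompact KU := isCompact_Icc.prod ((isCompact_closedBall _ _).prod hUc)
  have hfK : ContinuousOn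
      (fun z : ℝ × EuclideanSpace ℝ (Fin n) × (Fin m → ℝ) => f z.1 z.2.1 z.2.2) KU :=
    hfc.mono (Set.prod_mono le_rfl (Set.prod_mono (Set.subset_univ _) le_rfl))
  obtain ⟨C0, hC0⟩ := hKUc.exists_bound_of_continuousOn hfK
  obtain ⟨C, hC, hCpos⟩ : ∃ C, (∀ r ∈ Set.Icc t T, ‖f r (X r) (u r)‖ ≤ C) ∧ 0 < C :=
    ⟨max C0 1, fun r hr => (hC0 (r, X r, u r) ⟨(hXK r hr).1, (hXK r hr).2, hu.2 r hr⟩).trans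
      (le_max_left _ _), by positivity⟩
  have hint := aux_integrable T U hUc f hfc t ht u hu X hXc C hC
  have hii : ∀ s1 ∈ Set.Icc t T, ∀ s2 ∈ Set.Icc t T,
      IntervalIntegrable (fun r => f r (X r) (u r)) MeasureTheory.volume s1 s2 := by
    intro s1 h1 s2 h2
    refine (hint.mono_set ?_).intervalIntegrable
    exact Set.uIcc_subset_Icc h1 h2
  have htT : t ∈ Set.Icc t T := ⟨le_rfl, ht.2⟩
  have hdiff : ∀ s1 ∈ Set.Icc t T, ∀ s2 ∈ Set.Icc t T,
      X s2 - X s1 = ∫ r in s1..s2, f r (X r) (u r) := by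
    intro s1 h1 s2 h2
    rw [hXi s1 h1, hXi s2 h2, add_sub_add_left_eq_sub]
    exact intervalIntegral.integral_interval_sub_left (hii t htT s2 h2) (hii t htT s1 h1)
  have hlip : ∀ s1 ∈ Set.Icc t T, ∀ s2 ∈ Set.Icc t T, s1 ≤ s2 →
      ‖X s2 - X s1‖ ≤ C * (s2 - s1) := by
    intro s1 h1 s2 h2 h12
    rw [hdiff s1 h1 s2 h2]
    have := intervalIntegral.norm_integral_le_of_norm_le_const (a := s1) (b := s2) (C := C)
      (f := fun r => f r (X r) (u r)) (fun r hr => by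
        rw [Set.uIoc_of_le h12] at hr
        exact hC r ⟨h1.1.trans hr.1.le, hr.2.trans h2.2⟩)
    rwa [abs_of_nonneg (by linarith)] at this
  have main : ∀ η : ℝ, 0 < η →
      vlow a (X a) ≤ vlow b (X b) + (1 + (2 * L + 1) * (b - a)) * η := by
    intro η hη
    obtain ⟨ρ0, hρ0, hρv⟩ := Metric.uniformContinuousOn_iff.1
      (hKc.uniformContinuousOn_of_continuous hvK) η hη
    obtain ⟨ρ, hρ, hρρ, hρa, hρb, hρ1⟩ : ∃ ρ : ℝ, 0 < ρ ∧ ρ ≤ ρ0 ∧ ρ ≤ a ∧ ρ ≤ T - b ∧ ρ ≤ 1 := by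
      have : 0 < T - b := by linarith
      exact ⟨min ρ0 (min a (min (T - b) 1)), by positivity, min_le_left _ _,
        (min_le_right _ _).trans (min_le_left _ _),
        (min_le_right _ _).trans ((min_le_right _ _).trans (min_le_left _ _)),
        (min_le_right _ _).trans ((min_le_right _ _).trans (min_le_right _ _))⟩
    obtain ⟨B, hB, hBρ⟩ : ∃ B : ℝ, 0 < B ∧ 2 * M < B * ρ ^ 2 :=
      ⟨(2 * M + 1) / ρ ^ 2, by positivity, by rw [div_mul_cancel₀ _ (by positivity)]; linarith⟩
    obtain ⟨κ, hκ, hκη⟩ : ∃ κ : ℝ, 0 < κ ∧ 2 * B * ρ * κ ≤ η :=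
      ⟨η / (2 * B * ρ), by positivity, by rw [mul_div_cancel₀ _ (by positivity)]⟩
    obtain ⟨σ, hσ, hσf⟩ := Metric.uniformContinuousOn_iff.1
      (hKUc.uniformContinuousOn_of_continuous hfK) κ hκ
    obtain ⟨ν, hν, hνρ, hνσ⟩ : ∃ ν : ℝ, 0 < ν ∧ ν ≤ ρ ∧ ν ≤ σ / 2 :=
      ⟨min ρ (σ / 2), by positivity, min_le_left _ _, min_le_right _ _⟩
    obtain ⟨A, hA, hAν⟩ : ∃ A : ℝ, 0 < A ∧ 2 * M < A * ν ^ 2 :=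
      ⟨(2 * M + 1) / ν ^ 2, by positivity, by rw [div_mul_cancel₀ _ (by positivity)]; linarith⟩
    -- maximizers
    have hex : ∀ s : ℝ, ∃ z ∈ K, ∀ z' ∈ K,
        vlow z'.1 z'.2 - A * (z'.1 - s) ^ 2 - B * ‖z'.2 - X s‖ ^ 2
          ≤ vlow z.1 z.2 - A * (z.1 - s) ^ 2 - B * ‖z.2 - X s‖ ^ 2 := by
      intro s
      obtain ⟨z, hz, hmz⟩ := hKc.exists_isMaxOn ⟨_, hXK t htT⟩
        (f := fun z : ℝ × EuclideanSpace ℝ (Fin n) =>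
          vlow z.1 z.2 - A * (z.1 - s) ^ 2 - B * ‖z.2 - X s‖ ^ 2)
        ((hvK.sub (by fun_prop)).sub (by fun_prop))
      exact ⟨z, hz, fun z' hz' => hmz hz'⟩
    choose Z hZK hZ using hex
    set W : ℝ → ℝ := fun s =>
      vlow (Z s).1 (Z s).2 - A * ((Z s).1 - s) ^ 2 - B * ‖(Z s).2 - X s‖ ^ 2 with hW
    have hsub' : ∀ s ∈ Set.Icc a b, s ∈ Set.Icc t T := fun s hs =>
      ⟨hta.trans hs.1, hs.2.trans hbT.le⟩
    have hWge : ∀ s ∈ Set.Icc a b, vlow s (X s) ≤ W s := by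
      intro s hs
      have := hZ s (s, X s) (hXK s (hsub' s hs))
      simpa using this
    have hfacts : ∀ s ∈ Set.Icc a b, |(Z s).1 - s| < ν ∧ ‖(Z s).2 - X s‖ < ρ ∧
        vlow (Z s).1 (Z s).2 < vlow s (X s) + η ∧ B * ‖(Z s).2 - X s‖ ^ 2 ≤ η := by
      intro s hs
      have h1 := hWge s hs
      simp only [hW] at h1
      have h2 := abs_le.1 (hM _ (hZK s))
      have h3 := abs_le.1 (hM _ (hXK s (hsub' s hs)))
      have p1 : 0 ≤ A * ((Z s).1 - s) ^ 2 := by positivity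
      have p2 : 0 ≤ B * ‖(Z s).2 - X s‖ ^ 2 := by positivity
      have c1 : |(Z s).1 - s| < ν := by
        refine abs_lt_of_sq_lt_sq ?_ hν.le
        have : A * ((Z s).1 - s) ^ 2 < A * ν ^ 2 := by simp only at h3; linarith
        exact lt_of_mul_lt_mul_left this hA.le
      have c2 : ‖(Z s).2 - X s‖ < ρ := by
        refine lt_of_pow_lt_pow_left₀ 2 hρ.le ?_
        have : B * ‖(Z s).2 - X s‖ ^ 2 < B * ρ ^ 2 := by simp only at h3; linarith
        exact lt_of_mul_lt_mul_left this hB.le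
      have c3 := hρv _ (hZK s) _ (hXK s (hsub' s hs)) (by
        rw [Prod.dist_eq, max_lt_iff, Real.dist_eq, dist_eq_norm]
        exact ⟨by linarith, by linarith⟩)
      rw [Real.dist_eq, abs_lt] at c3
      simp only at c3
      exact ⟨c1, c2, by linarith, by linarith⟩
    have hWle : W b ≤ vlow b (X b) + η := by
      have h1 := (hfacts b ⟨hab, le_rfl⟩).2.2.1
      have p1 : 0 ≤ A * ((Z b).1 - b) ^ 2 := by positivity
      have p2 : 0 ≤ B * ‖(Z b).2 - X b‖ ^ 2 := by positivity
      simp only [hW]; linarith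
    have hstep : ∀ s h, a ≤ s → 0 ≤ h → h < σ / 2 → s + h ≤ b →
        W s - ((2 * L + 1) * η) * h - (A + 2 * B * ρ * L * C + B * C ^ 2) * h ^ 2
          ≤ W (s + h) := by
      intro s h has hh0 hhσ hsb
      have hs : s ∈ Set.Icc a b := ⟨has, by linarith⟩
      have hsh : s + h ∈ Set.Icc a b := ⟨by linarith, hsb⟩
      obtain ⟨c1, c2, c3, c4⟩ := hfacts s hs
      have c1' := abs_lt.1 c1
      have hW1 := hWge s hs
      have hz := hZK s
      have hzm := hZ s
      have hz2 := hZ (s + h) (Z s) hz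
      have hWs : W s = vlow (Z s).1 (Z s).2 - A * ((Z s).1 - s) ^ 2 - B * ‖(Z s).2 - X s‖ ^ 2 := rfl
      have hWsh : vlow (Z s).1 (Z s).2 - A * ((Z s).1 - (s + h)) ^ 2
          - B * ‖(Z s).2 - X (s + h)‖ ^ 2 ≤ W (s + h) := hz2
      generalize Z s = z at *
      obtain ⟨s', y⟩ := z
      simp only at *
      have hs' : s' ∈ Set.Ioo 0 T := ⟨by linarith, by linarith [hs.2]⟩
      have hyn : ‖y‖ < R + 1 := by
        have h1 := hR s (hsub' s hs)
        have h2 : ‖y‖ ≤ ‖y - X s‖ + ‖X s‖ := by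
          simpa using norm_add_le (y - X s) (X s)
        linarith
      have hsg : IsSupGrad vlow s' y (2 * A * (s' - s)) ((2 * B) • (y - X s)) := by
        apply aux_supgrad vlow A B s s' hA hB (X s) y
        have : K ∈ nhds (s', y) := by
          apply prod_mem_nhds (Icc_mem_nhds hs'.1 hs'.2)
          apply Filter.mem_of_superset (Metric.isOpen_ball.mem_nhds _) Metric.ball_subset_closedBall
          rwa [mem_ball_zero_iff]
        filter_upwards [this] with z' hz'
        exact hzm z' hz'
      have hvpos : 0 < vlow s' y := by
        have p1 : 0 ≤ A * (s' - s) ^ 2 := by positivity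
        have p2 : 0 ≤ B * ‖y - X s‖ ^ 2 := by positivity
        linarith [hpos s hs]
      have hpde := hsub s' hs' y hvpos _ _ hsg
      set d := ‖y - X s‖ with hd
      have hd0 : 0 ≤ d := norm_nonneg _
      have hpn : ‖(2 * B) • (y - X s)‖ = 2 * B * d := by
        rw [norm_smul, Real.norm_of_nonneg (by positivity)]
      have hlow : ∀ r ∈ Set.Icc s (s + h),
          -(2 * A * (s' - s)) - 2 * B * d * (L * (d + C * h) + κ)
            ≤ ⟪(2 * B) • (y - X s), f r (X r) (u r)⟫ := by
        intro r hr
        have hrab : r ∈ Set.Icc a b := ⟨has.trans hr.1, hr.2.trans hsb⟩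
        have hrT := hsub' r hrab
        have hr0 : r ∈ Set.Icc 0 T := ⟨ht.1.trans hrT.1, hrT.2⟩
        have hur := hu.2 r hrT
        have g1 := hpde (u r) hur
        have g2 : ‖f r (X r) (u r) - f r y (u r)‖ ≤ L * (d + C * h) := by
          refine (hfl r hr0 (u r) hur _ _).trans ?_
          gcongr
          have k1 := hlip s (hsub' s hs) r hrT hr.1
          have k2 : ‖X r - y‖ ≤ ‖X r - X s‖ + ‖X s - y‖ := norm_sub_le_norm_sub_add_norm_sub _ _ _
          rw [norm_sub_rev (X s) y] at k2
          have k3 : C * (r - s) ≤ C * h := by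
            have := hr.2
            gcongr; linarith
          linarith
        have g3 : ‖f r y (u r) - f s' y (u r)‖ ≤ κ := by
          have hyb : y ∈ Metric.closedBall (0 : EuclideanSpace ℝ (Fin n)) (R + 1) := by
            rw [mem_closedBall_zero_iff]; exact hyn.le
          have := hσf (r, y, u r) ⟨hr0, hyb, hur⟩ (s', y, u r) ⟨⟨hs'.1.le, hs'.2.le⟩, hyb, hur⟩ (by
            simp only [Prod.dist_eq, dist_self, Real.dist_eq]
            have : |r - s'| < σ := by
              have := hr.1
              have := hr.2
              rw [abs_lt]; constructor <;> linarith
            simpa [hσ] using this)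
          rw [dist_eq_norm] at this
          exact this.le
        have g4 : ‖f r (X r) (u r) - f s' y (u r)‖ ≤ L * (d + C * h) + κ :=
          (norm_sub_le_norm_sub_add_norm_sub _ _ _).trans (add_le_add g2 g3)
        have g5 := abs_le.1 (abs_real_inner_le_norm ((2 * B) • (y - X s))
          (f r (X r) (u r) - f s' y (u r)))
        rw [hpn, inner_sub_right] at g5
        have g6 : 2 * B * d * ‖f r (X r) (u r) - f s' y (u r)‖
            ≤ 2 * B * d * (L * (d + C * h) + κ) := by gcongr
        linarith [g5.1]
      have hI := aux_inner_int (fun r => f r (X r) (u r)) _ _ s h hh0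
        (hii s (hsub' s hs) (s + h) (hsub' _ hsh)) hlow
      rw [← hdiff s (hsub' s hs) (s + h) (hsub' _ hsh), real_inner_smul_left] at hI
      have hDl := hlip s (hsub' s hs) (s + h) (hsub' _ hsh) (by linarith)
      have e1 : ‖y - X (s + h)‖ ^ 2
          = d ^ 2 - 2 * ⟪y - X s, X (s + h) - X s⟫ + ‖X (s + h) - X s‖ ^ 2 := by
        have : y - X (s + h) = (y - X s) - (X (s + h) - X s) := by abel
        rw [this, norm_sub_sq_real]
      rw [e1] at hWsh
      have q1 : ‖X (s + h) - X s‖ ^ 2 ≤ (C * h) ^ 2 := by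
        gcongr; simpa using hDl
      have q2 : B * ‖X (s + h) - X s‖ ^ 2 ≤ B * (C * h) ^ 2 := by gcongr
      have q3 : 2 * B * d * (L * (d + C * h) + κ)
          ≤ (2 * L + 1) * η + 2 * B * ρ * L * C * h := by
        have k1 : 2 * B * d * κ ≤ 2 * B * ρ * κ := by gcongr
        have k2 : 2 * B * d * (L * (C * h)) ≤ 2 * B * ρ * (L * (C * h)) := by gcongr
        have k3 : 2 * L * (B * d ^ 2) ≤ 2 * L * η := by gcongr
        linarith only [k1, k2, k3, hκη]
      have q4 := mul_le_mul_of_nonneg_left q3 hh0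
      linarith only [q4, q2, hWsh, hWs, hI]
    have hsum := aux_step_sum W a b _ _ (σ / 2) hab (by positivity) hstep
    have := hWge a ⟨le_rfl, hab⟩
    linarith
  have hc : 0 < 1 + (2 * L + 1) * (b - a) := by
    have : 0 ≤ (2 * L + 1) * (b - a) := mul_nonneg (by linarith) (by linarith)
    linarith
  refine le_of_forall_pos_le_add fun ε hε => ?_
  have := main (ε / (1 + (2 * L + 1) * (b - a))) (by positivity)
  rwa [mul_div_cancel₀ _ hc.ne'] at this

/-- If `v̲` is a continuous viscosity subsolution of `−v_t + H(t,x,∇v) = 0` on its strict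
zero-superlevel set and the terminal data `g̲` is nonpositive on the target `𝒳 = {g ≤ 0}`,
then the zero-sublevel sets of `v̲` over-approximate the backwards reachable set. -/
theorem over_approx_BRS {n m : ℕ} (T : ℝ) (hT : 0 < T)
    (U : Set (Fin m → ℝ)) (hUc : IsCompact U) (hUne : U.Nonempty)
    (f : ℝ → EuclideanSpace ℝ (Fin n) → (Fin m → ℝ) → EuclideanSpace ℝ (Fin n))
    (hfc : ContinuousOn
      (fun z : ℝ × EuclideanSpace ℝ (Fin n) × (Fin m → ℝ) => f z.1 z.2.1 z.2.2)
      (Set.Icc 0 T ×ˢ (Set.univ : Set (EuclideanSpace ℝ (Fin n))) ×ˢ U))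
    (L : ℝ) (hL : 0 ≤ L)
    (hfl : ∀ s ∈ Set.Icc (0 : ℝ) T, ∀ w ∈ U, ∀ x y : EuclideanSpace ℝ (Fin n),
      ‖f s x w - f s y w‖ ≤ L * ‖x - y‖)
    (H : ℝ → EuclideanSpace ℝ (Fin n) → EuclideanSpace ℝ (Fin n) → ℝ)
    (hH : ∀ t ∈ Set.Icc (0 : ℝ) T, ∀ x p,
      IsGreatest ((fun w => ⟪-p, f t x w⟫) '' U) (H t x p))
    (g : EuclideanSpace ℝ (Fin n) → ℝ) (hg : Continuous g)
    (vlow : ℝ → EuclideanSpace ℝ (Fin n) → ℝ)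
    (hvc : ContinuousOn (fun z : ℝ × EuclideanSpace ℝ (Fin n) => vlow z.1 z.2)
      (Set.Icc 0 T ×ˢ (Set.univ : Set (EuclideanSpace ℝ (Fin n)))))
    (hsub : ∀ t₀ ∈ Set.Ioo (0 : ℝ) T, ∀ x₀, 0 < vlow t₀ x₀ →
      ∀ pt px, IsSupGrad vlow t₀ x₀ pt px → -pt + H t₀ x₀ px ≤ 0)
    (glow : EuclideanSpace ℝ (Fin n) → ℝ)
    (hterm : ∀ x, vlow T x = glow x)
    (hglow : ∀ x, g x ≤ 0 → glow x ≤ 0) :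
    ∀ t ∈ Set.Icc (0 : ℝ) T, Reach U f g T t ⊆ {x | vlow t x ≤ 0} := by
  intro t ht x hx
  obtain ⟨u, X, hu, hX, hgX⟩ := hx
  rw [Set.mem_ofPred_eq]
  by_contra hneg
  push Not at hneg
  have htT : t ∈ Set.Icc t T := ⟨le_rfl, ht.2⟩
  have hXt : X t = x := by simpa using hX.2 t htT
  set w : ℝ → ℝ := fun s => vlow s (X s) with hw
  have hwc : ContinuousOn w (Set.Icc t T) :=
    hvc.comp (continuousOn_id.prodMk hX.1) (fun s hs => ⟨⟨ht.1.trans hs.1, hs.2⟩, trivial⟩)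
  have hwt : 0 < w t := by simpa [hw, hXt] using hneg
  have hwT : w T ≤ 0 := by
    simp only [hw]; rw [hterm]; exact hglow _ hgX
  set S : Set ℝ := Set.Icc t T ∩ w ⁻¹' Set.Iic 0 with hS
  have hSc : IsCompact S :=
    isCompact_Icc.of_isClosed_subset (hwc.preimage_isClosed_of_isClosed isClosed_Icc isClosed_Iic)
      Set.inter_subset_left
  have hSne : S.Nonempty := ⟨T, ⟨ht.2, le_rfl⟩, hwT⟩
  have hτ := hSc.sInf_mem hSne
  have hlow : ∀ s ∈ S, sInf S ≤ s := fun s hs => csInf_le hSc.bddBelow hs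
  generalize sInf S = τ at hτ hlow
  obtain ⟨⟨htτ, hτT⟩, hwτ⟩ := hτ
  replace hwτ : w τ ≤ 0 := hwτ
  have htτ' : t < τ := lt_of_le_of_ne htτ (by rintro rfl; linarith)
  have hpos : ∀ s, t ≤ s → s < τ → 0 < w s := by
    intro s h1 h2
    by_contra h3
    exact absurd (hlow s ⟨⟨h1, by linarith⟩, not_lt.1 h3⟩) (not_le.2 h2)
  obtain ⟨a, hta, haτ⟩ := exists_between htτ'
  have hmono : ∀ b ∈ Set.Ioo a τ, w a ≤ w b := by
    intro b hb
    refine aux_core T U hUc f hfc L hL hfl vlow hvc ?_ t ht x u hu X hX a b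
      (by linarith [ht.1]) hta.le hb.1.le (by linarith [hb.2]) ?_
    · intro t₀ ht₀ x₀ hv pt px hsg p hp
      have h1 := hsub t₀ ht₀ x₀ hv pt px hsg
      have h2 := (hH t₀ ⟨ht₀.1.le, ht₀.2.le⟩ x₀ px).2 ⟨p, hp, rfl⟩
      simp only [inner_neg_left] at h2
      linarith
    · intro s hs
      exact hpos s (hta.le.trans hs.1) (lt_of_le_of_lt hs.2 hb.2)
  have hcw : Filter.Tendsto w (nhdsWithin τ (Set.Ioo a τ)) (nhds (w τ)) :=
    (hwc τ ⟨htτ, hτT⟩).mono_left (nhdsWithin_mono _ fun s hs =>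
      ⟨hta.le.trans hs.1.le, hs.2.le.trans hτT⟩)
  have : (nhdsWithin τ (Set.Ioo a τ)).NeBot := right_nhdsWithin_Ioo_neBot haτ
  have hfin : w a ≤ w τ := ge_of_tendsto hcw (by
    filter_upwards [self_mem_nhdsWithin] with b hb
    exact hmono b hb)
  linarith [hpos a hta.le haτ]

end
end
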